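/- arXiv:1909.05953 — 5 statements merged into one kernel-verified Lean document; each statement's English description precedes it below -/
import Mathlib

section
/- Let S be a finite set of open unit semicircles. If the union of S covers the entire unit circle S^1, then there exists a subset R of S of cardinality 3 or 4 whose union still covers S^1. -/
open scoped RealInnerProductSpace

/-- The unit circle `S¹ ⊆ ℝ²`. -/
noncomputable def unitCircle : Set (EuclideanSpace ℝ (Fin 2)) := Metric.sphere 0 1

/-- The open unit semicircle of `S¹` determined by a (unit) vector `v`. -/
noncomputable def openSemicircle (v : EuclideanSpace ℝ (Fin 2)) :
    Set (EuclideanSpace ℝ (Fin 2)) := {x ∈ unitCircle | 0 < ⟪v, x⟫}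

/-- Covering the unit circle by open semicircles, in coordinates. -/
theorem unitCircle_subset_iff (R : Finset (EuclideanSpace ℝ (Fin 2))) :
    unitCircle ⊆ ⋃ v ∈ R, openSemicircle v ↔
      ∀ x y : ℝ, x ^ 2 + y ^ 2 = 1 → ∃ v ∈ R, 0 < v 0 * x + v 1 * y := by
  constructor
  · intro h x y hxy
    have hmem : !₂[x, y] ∈ unitCircle := by
      simp [unitCircle, EuclideanSpace.norm_eq, Fin.sum_univ_two, hxy]
    obtain ⟨v, hv, hvx⟩ := Set.mem_iUnion₂.1 (h hmem)
    refine ⟨v, hv, ?_⟩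
    have := hvx.2
    simp only [PiLp.inner_apply, Fin.sum_univ_two] at this
    simpa [mul_comm] using this
  · intro h x hx
    have hxy : x 0 ^ 2 + x 1 ^ 2 = 1 := by
      have hn : ‖x‖ = 1 := by simpa [unitCircle] using hx
      have := EuclideanSpace.real_norm_sq_eq x
      rw [hn, Fin.sum_univ_two] at this
      linarith
    obtain ⟨v, hv, hvx⟩ := h _ _ hxy
    refine Set.mem_iUnion₂.2 ⟨v, hv, hx, ?_⟩
    simp only [PiLp.inner_apply, Fin.sum_univ_two]
    simpa [mul_comm] using hvx

/-- The determinant of two plane vectors. -/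
def planeDet (p q : EuclideanSpace ℝ (Fin 2)) : ℝ := p 0 * q 1 - p 1 * q 0

/-- Three plane vectors whose consecutive determinants are positive are not contained in a closed
half-plane. -/
theorem exists_pos_of_planeDet_pos {p q r : EuclideanSpace ℝ (Fin 2)}
    (hpq : 0 < planeDet p q) (hqr : 0 < planeDet q r) (hrp : 0 < planeDet r p)
    {x y : ℝ} (hxy : x ^ 2 + y ^ 2 = 1) :
    0 < p 0 * x + p 1 * y ∨ 0 < q 0 * x + q 1 * y ∨ 0 < r 0 * x + r 1 * y := by
  by_contra! h
  obtain ⟨hp, hq, hr⟩ := h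
  have hsum : planeDet q r * (p 0 * x + p 1 * y) + planeDet r p * (q 0 * x + q 1 * y) +
      planeDet p q * (r 0 * x + r 1 * y) = 0 := by
    simp only [planeDet]; ring
  have h₁ := mul_nonpos_of_nonneg_of_nonpos hqr.le hp
  have h₂ := mul_nonpos_of_nonneg_of_nonpos hrp.le hq
  have h₃ := mul_nonpos_of_nonneg_of_nonpos hpq.le hr
  have hp0 : p 0 * x + p 1 * y = 0 :=
    (mul_eq_zero.1 (by linarith : planeDet q r * (p 0 * x + p 1 * y) = 0)).resolve_left hqr.ne'
  have hq0 : q 0 * x + q 1 * y = 0 :=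
    (mul_eq_zero.1 (by linarith : planeDet r p * (q 0 * x + q 1 * y) = 0)).resolve_left hrp.ne'
  have hx : planeDet p q * x = 0 := by
    simp only [planeDet]; linear_combination q 1 * hp0 - p 1 * hq0
  have hy : planeDet p q * y = 0 := by
    simp only [planeDet]; linear_combination p 0 * hq0 - q 0 * hp0
  have hx0 := (mul_eq_zero.1 hx).resolve_left hpq.ne'
  have hy0 := (mul_eq_zero.1 hy).resolve_left hpq.ne'
  simp [hx0, hy0] at hxy

/-- Among the vectors of a finite set to the left of a unit vector `v`, there is one furthest from
`v` in the positive direction. -/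
theorem exists_planeDet_pos_forall_nonpos {S : Finset (EuclideanSpace ℝ (Fin 2))}
    {v : EuclideanSpace ℝ (Fin 2)} (hv : v 0 ^ 2 + v 1 ^ 2 = 1)
    (h : ∃ u ∈ S, 0 < planeDet v u) :
    ∃ a ∈ S, 0 < planeDet v a ∧ ∀ u ∈ S, 0 < planeDet v u → planeDet a u ≤ 0 := by
  obtain ⟨u₀, hu₀, hpos⟩ := h
  obtain ⟨a, ha, hmin⟩ := (S.filter (0 < planeDet v ·)).exists_min_image
    (fun u => (v 0 * u 0 + v 1 * u 1) / planeDet v u) ⟨u₀, by simp [hu₀, hpos]⟩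
  rw [Finset.mem_filter] at ha
  refine ⟨a, ha.1, ha.2, fun u hu hvu => ?_⟩
  have hle := hmin u (by simp [hu, hvu])
  rw [div_le_div_iff₀ ha.2 hvu] at hle
  simp only [planeDet] at hle ⊢
  linear_combination hle - (a 0 * u 1 - a 1 * u 0) * hv

/-- Among the vectors of a finite set to the right of a unit vector `v`, there is one furthest from
`v` in the negative direction. -/
theorem exists_planeDet_neg_forall_nonneg {S : Finset (EuclideanSpace ℝ (Fin 2))}
    {v : EuclideanSpace ℝ (Fin 2)} (hv : v 0 ^ 2 + v 1 ^ 2 = 1)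
    (h : ∃ u ∈ S, planeDet v u < 0) :
    ∃ b ∈ S, planeDet v b < 0 ∧ ∀ u ∈ S, planeDet v u < 0 → 0 ≤ planeDet b u := by
  obtain ⟨u₀, hu₀, hneg⟩ := h
  obtain ⟨b, hb, hmax⟩ := (S.filter (planeDet v · < 0)).exists_max_image
    (fun u => (v 0 * u 0 + v 1 * u 1) / planeDet v u) ⟨u₀, by simp [hu₀, hneg]⟩
  rw [Finset.mem_filter] at hb
  refine ⟨b, hb.1, hb.2, fun u hu hvu => ?_⟩
  have hle := hmax u (by simp [hu, hvu])
  rw [← neg_div_neg_eq, ← neg_div_neg_eq (v 0 * b 0 + v 1 * b 1),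
    div_le_div_iff₀ (neg_pos.2 hvu) (neg_pos.2 hb.2)] at hle
  simp only [planeDet] at hle ⊢
  linear_combination hle + (b 0 * u 1 - b 1 * u 0) * hv

/-- If a finite set of open unit semicircles covers the unit circle `S¹`,
then three or four of them already cover it. -/
theorem semicircles_cover_circle
    (S : Finset (EuclideanSpace ℝ (Fin 2))) (hS : ∀ v ∈ S, ‖v‖ = 1)
    (hcover : unitCircle ⊆ ⋃ v ∈ S, openSemicircle v) :
    ∃ R ⊆ S, (R.card = 3 ∨ R.card = 4) ∧
      unitCircle ⊆ ⋃ v ∈ R, openSemicircle v := by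
  classical
  have hunit : ∀ v ∈ S, v 0 ^ 2 + v 1 ^ 2 = 1 := by
    intro v hv
    have := EuclideanSpace.real_norm_sq_eq v
    rw [hS v hv, Fin.sum_univ_two] at this
    linarith
  rw [unitCircle_subset_iff] at hcover
  simp only [unitCircle_subset_iff]
  obtain ⟨v, hv, -⟩ := hcover 1 0 (by norm_num)
  have hv1 := hunit v hv
  obtain ⟨a, ha, hva, hamax⟩ := exists_planeDet_pos_forall_nonpos hv1 (by
    obtain ⟨u, hu, h⟩ := hcover (-v 1) (v 0) (by linarith)
    exact ⟨u, hu, by simp only [planeDet]; linarith⟩)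
  obtain ⟨b, hb, hvb, hbmax⟩ := exists_planeDet_neg_forall_nonneg hv1 (by
    obtain ⟨u, hu, h⟩ := hcover (v 1) (-v 0) (by linarith)
    exact ⟨u, hu, by simp only [planeDet]; linarith⟩)
  have hvv : planeDet v v = 0 := by simp only [planeDet]; ring
  have hav : v ≠ a := by rintro rfl; linarith
  have hbv : v ≠ b := by rintro rfl; linarith
  have hab : a ≠ b := by rintro rfl; linarith
  rcases lt_or_ge 0 (planeDet a b) with hdet | hdet
  · refine ⟨{v, a, b}, by simp [Finset.insert_subset_iff, hv, ha, hb],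
      Or.inl (Finset.card_eq_three.2 ⟨v, a, b, hav, hbv, hab, rfl⟩), fun x y hxy => ?_⟩
    have hbv' : 0 < planeDet b v := by
      simp only [planeDet] at hvb ⊢
      linarith
    simpa using exists_pos_of_planeDet_pos hva hdet hbv' hxy
  obtain ⟨u, hu, hau⟩ := hcover (-a 1) (a 0) (by linarith [hunit a ha])
  replace hau : 0 < planeDet a u := by simp only [planeDet]; linarith
  have hvu : planeDet v u = 0 := by
    rcases lt_trichotomy (planeDet v u) 0 with h | h | h
    · have hrel : planeDet v b * planeDet a u =
          planeDet v a * planeDet b u + planeDet v u * planeDet a b := by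
        simp only [planeDet]; ring
      have h₁ := mul_nonneg hva.le (hbmax u hu h)
      have h₂ := mul_nonneg_of_nonpos_of_nonpos h.le hdet
      have h₃ := mul_neg_of_neg_of_pos hvb hau
      linarith
    · exact h
    · exact absurd (hamax u hu h) hau.not_ge
  obtain ⟨d, hd⟩ : ∃ d, d = v 0 * u 0 + v 1 * u 1 := ⟨_, rfl⟩
  have hu0 : u 0 = d * v 0 := by
    simp only [planeDet] at hvu
    linear_combination -u 0 * hv1 - v 0 * hd - v 1 * hvu
  have hu1 : u 1 = d * v 1 := by
    simp only [planeDet] at hvu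
    linear_combination -u 1 * hv1 - v 1 * hd + v 0 * hvu
  have hdneg : d < 0 := by
    have hrel : planeDet a u = -d * planeDet v a := by
      simp only [planeDet, hu0, hu1]; ring
    rw [hrel] at hau
    linarith [pos_of_mul_pos_left hau hva.le]
  have hd1 : d = -1 := by
    have hsq : d ^ 2 = 1 := by
      have := hunit u hu
      rw [hu0, hu1] at this
      linear_combination this - d ^ 2 * hv1
    nlinarith
  rw [hd1] at hu0 hu1
  have huv : v ≠ u := by
    rintro rfl
    nlinarith
  have hau' : a ≠ u := by rintro rfl; linarith
  have hbu : b ≠ u := by rintro rfl; linarith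
  refine ⟨{v, u, a, b}, by simp [Finset.insert_subset_iff, hv, hu, ha, hb], Or.inr ?_,
    fun x y hxy => ?_⟩
  · simp [huv, hav, hbv, hau'.symm, hbu.symm, hab]
  rcases lt_trichotomy (v 0 * x + v 1 * y) 0 with h | h | h
  · exact ⟨u, by simp, by rw [hu0, hu1]; linarith⟩
  · obtain ⟨c, hc⟩ : ∃ c, c = v 0 * y - v 1 * x := ⟨_, rfl⟩
    have hx : x = -c * v 1 := by linear_combination -x * hv1 + v 0 * h + v 1 * hc
    have hy : y = c * v 0 := by linear_combination -y * hv1 + v 1 * h - v 0 * hc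
    have hdot (w : EuclideanSpace ℝ (Fin 2)) : w 0 * x + w 1 * y = c * planeDet v w := by
      rw [hx, hy, planeDet]; ring
    rcases lt_trichotomy c 0 with hc0 | hc0 | hc0
    · exact ⟨b, by simp, by rw [hdot]; exact mul_pos_of_neg_of_neg hc0 hvb⟩
    · simp [hx, hy, hc0] at hxy
    · exact ⟨a, by simp, by rw [hdot]; exact mul_pos hc0 hva⟩
  · exact ⟨v, by simp, h⟩
end

section
/- A set R of six open unit hemispheres that covers the unit sphere S^2 is minimal (removing any one member makes the family fail to cover S^2) if and only if R consists of three antipodal pairs of open unit hemispheres. -/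
open scoped RealInnerProductSpace

noncomputable local instance : DecidableEq (EuclideanSpace ℝ (Fin 3)) :=
  Classical.decEq _

/-- The unit sphere `S² ⊆ ℝ³`. -/
noncomputable def unitSphere : Set (EuclideanSpace ℝ (Fin 3)) := Metric.sphere 0 1

/-- The open unit hemisphere of `S²` determined by a (unit) vector `v`. -/
noncomputable def openHemisphere (v : EuclideanSpace ℝ (Fin 3)) :
    Set (EuclideanSpace ℝ (Fin 3)) := {x ∈ unitSphere | 0 < ⟪v, x⟫}

section PositiveSpanning

variable {E : Type*} [NormedAddCommGroup E] [InnerProductSpace ℝ E]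

/-- A finite set of vectors spans `E` positively if every nonzero vector has positive inner
product with one of its members. -/
def PositivelySpans (R : Finset E) : Prop := ∀ x : E, x ≠ 0 → ∃ w ∈ R, 0 < ⟪w, x⟫

/-- A positively spanning set in a finite-dimensional space generates it as a convex cone. -/
lemma PositivelySpans.exists_nonneg_sum_eq [FiniteDimensional ℝ E] {R : Finset E}
    (hR : PositivelySpans R) (p : E) :
    ∃ c : E → ℝ, (∀ w ∈ R, 0 ≤ c w) ∧ ∑ w ∈ R, c w • w = p := by
  by_cases hp : p = 0
  · exact ⟨0, by simp, by simp [hp]⟩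
  have hRne : R.Nonempty := let ⟨w, hw, _⟩ := hR p hp; ⟨w, hw⟩
  have hcont : Continuous fun x : E => R.sup' hRne fun w => ⟪w, x⟫ :=
    Continuous.finset_sup'_apply hRne fun w _ => by fun_prop
  have hsph : (Metric.sphere (0 : E) 1).Nonempty :=
    ⟨‖p‖⁻¹ • p, by simp [norm_smul, hp]⟩
  obtain ⟨x₀, hx₀, hmin⟩ := (isCompact_sphere (0 : E) 1).exists_isMinOn hsph hcont.continuousOn
  set δ := R.sup' hRne fun w => ⟪w, x₀⟫
  have hx₀ne : x₀ ≠ 0 := by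
    rintro rfl
    simp at hx₀
  have hδpos : 0 < δ := by
    obtain ⟨w, hw, hpos⟩ := hR x₀ hx₀ne
    exact (Finset.lt_sup'_iff hRne).2 ⟨w, hw, hpos⟩
  set ε := δ / (2 * ‖p‖) with hε
  have hppos : 0 < ‖p‖ := norm_pos_iff.2 hp
  have hεpos : 0 < ε := by positivity
  have hmem : ε • p ∈ convexHull ℝ (R : Set E) := by
    by_contra hnot
    obtain ⟨f, u, hlt, hu⟩ := geometric_hahn_banach_closed_point (convex_convexHull ℝ _)
      (R.finite_toSet.isClosed_convexHull ℝ) hnot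
    set y := (InnerProductSpace.toDual ℝ E).symm f with hy
    have hfy : ∀ z, f z = ⟪z, y⟫ := fun z => by
      rw [real_inner_comm, hy, InnerProductSpace.toDual_symm_apply]
    have hyne : y ≠ 0 := by
      intro h0
      obtain ⟨w, hw⟩ := hRne
      have h1 := hlt w (subset_convexHull ℝ _ hw)
      simp only [hfy, h0, inner_zero_right] at h1 hu
      linarith
    have hypos : 0 < ‖y‖ := norm_pos_iff.2 hyne
    have hys : ‖y‖⁻¹ • y ∈ Metric.sphere (0 : E) 1 := by simp [norm_smul, hyne]
    obtain ⟨w, hw, hwle⟩ := (Finset.le_sup'_iff hRne).1 (isMinOn_iff.1 hmin _ hys)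
    have h1 := hlt w (subset_convexHull ℝ _ hw)
    rw [hfy] at h1
    rw [hfy, real_inner_smul_left] at hu
    rw [real_inner_smul_right, inv_mul_eq_div, le_div_iff₀ hypos] at hwle
    have h2 := mul_le_mul_of_nonneg_left (real_inner_le_norm p y) hεpos.le
    have h3 : ε * (‖p‖ * ‖y‖) = δ * ‖y‖ / 2 := by
      rw [hε]; field_simp
    have := mul_pos hδpos hypos
    linarith
  obtain ⟨c, hc, -, hsum⟩ := Finset.mem_convexHull'.1 hmem
  refine ⟨fun w => ε⁻¹ * c w, fun w hw => mul_nonneg (by positivity) (hc w hw), ?_⟩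
  simp only [mul_smul]
  rw [← Finset.smul_sum, hsum, smul_smul, inv_mul_cancel₀ hεpos.ne', one_smul]

/-- Carathéodory's theorem for convex cones. -/
lemma exists_linearIndepOn_pos_sum_eq {V : Type*} [AddCommGroup V] [Module ℝ V] (R : Finset V)
    (c : V → ℝ) (hc : ∀ w ∈ R, 0 ≤ c w) :
    ∃ S ⊆ R, ∃ d : V → ℝ, (∀ w ∈ S, 0 < d w) ∧ ∑ w ∈ S, d w • w = ∑ w ∈ R, c w • w ∧
      LinearIndepOn ℝ id (S : Set V) := by
  classical
  induction R using Finset.strongInduction generalizing c with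
  | H R ih =>
  by_cases hzero : ∃ w ∈ R, c w = 0
  · obtain ⟨w, hw, hcw⟩ := hzero
    obtain ⟨S, hS, d, hd, hsum, hind⟩ := ih (R.erase w) (Finset.erase_ssubset hw) c
      fun z hz => hc z (Finset.mem_of_mem_erase hz)
    exact ⟨S, hS.trans (Finset.erase_subset _ _), d, hd,
      hsum.trans (Finset.sum_erase _ (by simp [hcw])), hind⟩
  push Not at hzero
  have hcpos : ∀ w ∈ R, 0 < c w := fun w hw => (hc w hw).lt_of_ne' (hzero w hw)
  by_cases hind : LinearIndepOn ℝ id (R : Set V)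
  · exact ⟨R, subset_rfl, c, hcpos, rfl, hind⟩
  obtain ⟨g, hg, w₁, hw₁, hgw₁⟩ : ∃ g : V → ℝ, ∑ w ∈ R, g w • w = 0 ∧ ∃ w ∈ R, 0 < g w := by
    rw [linearIndepOn_finset_iff] at hind
    push Not at hind
    obtain ⟨g, hg, w, hw, hgw⟩ := hind
    rcases hgw.lt_or_gt with hneg | hpos
    · exact ⟨-g, by simpa using hg, w, hw, by simpa using hneg⟩
    · exact ⟨g, hg, w, hw, hpos⟩
  obtain ⟨w₀, hw₀, hmin⟩ := {w ∈ R | 0 < g w}.exists_min_image (fun w => c w / g w)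
    ⟨w₁, Finset.mem_filter.2 ⟨hw₁, hgw₁⟩⟩
  obtain ⟨hw₀R, hgw₀⟩ := Finset.mem_filter.1 hw₀
  set t := c w₀ / g w₀ with ht
  have htpos : 0 < t := div_pos (hcpos w₀ hw₀R) hgw₀
  obtain ⟨S, hS, d, hd, hsum, hind⟩ := ih (R.erase w₀) (Finset.erase_ssubset hw₀R)
    (fun w => c w - t * g w) (by
      intro w hw
      have hwR := Finset.mem_of_mem_erase hw
      rcases lt_or_ge 0 (g w) with hpos | hneg
      · have := hmin w (Finset.mem_filter.2 ⟨hwR, hpos⟩)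
        rw [le_div_iff₀ hpos] at this
        linarith
      · have := mul_nonpos_of_nonneg_of_nonpos htpos.le hneg
        linarith [hcpos w hwR])
  refine ⟨S, hS.trans (Finset.erase_subset _ _), d, hd, hsum.trans ?_, hind⟩
  rw [Finset.sum_erase _ (by rw [ht, div_mul_cancel₀ _ hgw₀.ne', sub_self, zero_smul])]
  simp only [sub_smul, mul_smul, Finset.sum_sub_distrib]
  rw [← Finset.smul_sum, hg, smul_zero, sub_zero]

/-- If `-v` is a positive combination of `S`, then a set containing `v` and `S` spans positively as
soon as it does so with respect to vectors orthogonal to `S`. -/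
lemma positivelySpans_of_orthogonal {S T : Finset E} {v : E} (d : E → ℝ) (hd : ∀ w ∈ S, 0 < d w)
    (hsum : ∑ w ∈ S, d w • w = -v) (hST : S ⊆ T) (hvT : v ∈ T)
    (h : ∀ x ∈ (Submodule.span ℝ (S : Set E))ᗮ, x ≠ 0 → ∃ w ∈ T, 0 < ⟪w, x⟫) :
    PositivelySpans T := by
  intro x hx
  by_contra! hle
  have hterm : ∀ w ∈ S, d w * ⟪w, x⟫ ≤ 0 := fun w hw =>
    mul_nonpos_of_nonneg_of_nonpos (hd w hw).le (hle w (hST hw))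
  have hinner : ∑ w ∈ S, d w * ⟪w, x⟫ = -⟪v, x⟫ := by
    rw [← inner_neg_left, ← hsum, sum_inner]
    simp only [real_inner_smul_left]
  have hzero : ∀ w ∈ S, d w * ⟪w, x⟫ = 0 :=
    (Finset.sum_eq_zero_iff_of_nonpos hterm).1
      (le_antisymm (Finset.sum_nonpos hterm) (by linarith [hle v hvT]))
  have hxS : x ∈ (Submodule.span ℝ (S : Set E))ᗮ := by
    rw [Submodule.mem_orthogonal]
    intro u hu
    induction hu using Submodule.span_induction with
    | mem w hw => exact (mul_eq_zero.1 (hzero w hw)).resolve_left (hd w hw).ne'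
    | zero => simp
    | add a b _ _ ha hb => rw [inner_add_left, ha, hb, add_zero]
    | smul r a _ ha => rw [real_inner_smul_left, ha, mul_zero]
  obtain ⟨w, hw, hpos⟩ := h x hxS hx
  exact (hle w hw).not_gt hpos

/-- In dimension three, if `-v` is a positive combination of at least two linearly independent
members of a positively spanning set, then five members already span positively. -/
lemma PositivelySpans.exists_card_le_five [FiniteDimensional ℝ E]
    (hE : Module.finrank ℝ E = 3) {R S : Finset E} (hR : PositivelySpans R) (hSR : S ⊆ R)
    {v : E} (hv : v ∈ R) (d : E → ℝ) (hd : ∀ w ∈ S, 0 < d w) (hsum : ∑ w ∈ S, d w • w = -v)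
    (hind : LinearIndepOn ℝ id (S : Set E)) (hcard : 2 ≤ S.card) :
    ∃ T ⊆ R, T.card ≤ 5 ∧ PositivelySpans T := by
  classical
  have hspan : Module.finrank ℝ (Submodule.span ℝ (S : Set E)) = S.card :=
    finrank_span_finset_eq_card hind
  have hadd := Submodule.finrank_add_finrank_orthogonal (Submodule.span ℝ (S : Set E))
  rw [hspan, hE] at hadd
  obtain h2 | h3 : S.card = 2 ∨ S.card = 3 := by omega
  · obtain ⟨⟨n, hn⟩, hn0, hgen⟩ := finrank_eq_one_iff'.1
      (show Module.finrank ℝ (Submodule.span ℝ (S : Set E))ᗮ = 1 by omega)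
    have hn0 : n ≠ 0 := fun h => hn0 (Subtype.ext h)
    obtain ⟨p, hpR, hp⟩ := hR n hn0
    obtain ⟨q, hqR, hq⟩ := hR (-n) (neg_ne_zero.2 hn0)
    refine ⟨insert v (insert p (insert q S)), ?_, ?_,
      positivelySpans_of_orthogonal d hd hsum ?_ (by simp) fun x hx hx0 => ?_⟩
    · simp [Finset.insert_subset_iff, *]
    · have h1 := Finset.card_insert_le v (insert p (insert q S))
      have h2 := Finset.card_insert_le p (insert q S)
      have h3 := Finset.card_insert_le q S
      omega
    · intro w hw
      simp [hw]
    · obtain ⟨c, hc⟩ := hgen ⟨x, hx⟩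
      obtain rfl : c • n = x := congrArg Subtype.val hc
      rcases lt_trichotomy c 0 with hneg | rfl | hpos
      · refine ⟨q, by simp, ?_⟩
        rw [inner_neg_right] at hq
        rw [real_inner_smul_right]
        nlinarith
      · simp at hx0
      · exact ⟨p, by simp, by rw [real_inner_smul_right]; positivity⟩
  · have hbot : (Submodule.span ℝ (S : Set E))ᗮ = ⊥ := Submodule.finrank_eq_zero.1 (by omega)
    refine ⟨insert v S, Finset.insert_subset hv hSR, ?_,
      positivelySpans_of_orthogonal d hd hsum (Finset.subset_insert _ _) (by simp)
        fun x hx hx0 => ?_⟩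
    · have := Finset.card_insert_le v S
      omega
    · rw [hbot, Submodule.mem_bot] at hx
      exact absurd hx hx0

/-- A set of unit vectors in dimension three that spans positively, while no five of its members
do, is closed under negation. -/
lemma PositivelySpans.neg_mem [FiniteDimensional ℝ E] (hE : Module.finrank ℝ E = 3)
    {R : Finset E} (hR : PositivelySpans R) (hunit : ∀ v ∈ R, ‖v‖ = 1)
    (hmin : ∀ T ⊆ R, T.card ≤ 5 → ¬ PositivelySpans T) {v : E} (hv : v ∈ R) : -v ∈ R := by
  obtain ⟨c, hc, hcsum⟩ := hR.exists_nonneg_sum_eq (-v)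
  obtain ⟨S, hSR, d, hd, hsum, hind⟩ := exists_linearIndepOn_pos_sum_eq R c hc
  rw [hcsum] at hsum
  have hcard : S.card < 2 := by
    by_contra! h
    obtain ⟨T, hTR, hT, hTspan⟩ := hR.exists_card_le_five hE hSR hv d hd hsum hind h
    exact hmin T hTR hT hTspan
  obtain h0 | h1 : S.card = 0 ∨ S.card = 1 := by omega
  · rw [Finset.card_eq_zero] at h0
    subst h0
    have hv1 := hunit v hv
    rw [Finset.sum_empty, eq_comm, neg_eq_zero] at hsum
    simp [hsum] at hv1
  · obtain ⟨w, rfl⟩ := Finset.card_eq_one.1 h1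
    rw [Finset.sum_singleton] at hsum
    have hw : w ∈ R := hSR (by simp)
    have hdw := hd w (by simp)
    have hnorm := congrArg norm hsum
    rw [norm_smul, norm_neg, hunit v hv, hunit w hw, Real.norm_of_nonneg hdw.le, mul_one] at hnorm
    rw [hnorm, one_smul] at hsum
    exact hsum ▸ hw

/-- In dimension three, two lines and a single further vector do not span positively. -/
lemma not_positivelySpans_of_subset [FiniteDimensional ℝ E] (hE : Module.finrank ℝ E = 3)
    (a b c : E) {T : Finset E} (hT : ∀ x ∈ T, x = a ∨ x = b ∨ x = -b ∨ x = c ∨ x = -c) :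
    ¬ PositivelySpans T := by
  classical
  intro h
  have hspan : Module.finrank ℝ (Submodule.span ℝ (({b, c} : Finset E) : Set E)) ≤ 2 :=
    (finrank_span_finset_le_card _).trans Finset.card_le_two
  have hadd := Submodule.finrank_add_finrank_orthogonal
    (Submodule.span ℝ (({b, c} : Finset E) : Set E))
  have hne : (Submodule.span ℝ (({b, c} : Finset E) : Set E))ᗮ ≠ ⊥ := by
    rw [← Submodule.one_le_finrank_iff]
    omega
  obtain ⟨n, hn, hn0⟩ := Submodule.exists_mem_ne_zero_of_ne_bot hne
  obtain ⟨x, hx, hx0, hax⟩ : ∃ x ∈ (Submodule.span ℝ (({b, c} : Finset E) : Set E))ᗮ,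
      x ≠ 0 ∧ ⟪a, x⟫ ≤ 0 := by
    rcases le_total ⟪a, n⟫ 0 with hle | hge
    · exact ⟨n, hn, hn0, hle⟩
    · exact ⟨-n, neg_mem hn, neg_ne_zero.2 hn0, by simpa [inner_neg_right] using hge⟩
  rw [Submodule.mem_orthogonal] at hx
  have hb : ⟪b, x⟫ = 0 := hx b (Submodule.subset_span (by simp))
  have hc : ⟪c, x⟫ = 0 := hx c (Submodule.subset_span (by simp))
  obtain ⟨w, hw, hpos⟩ := h x hx0
  rcases hT w hw with rfl | rfl | rfl | rfl | rfl
  · exact hpos.not_ge hax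
  all_goals simp [inner_neg_left, hb, hc] at hpos

/-- A negation-closed set of six nonzero vectors consists of three pairs of opposite vectors. -/
lemma exists_eq_three_pairs [DecidableEq E] {R : Finset E} (hcard : R.card = 6)
    (h0 : ∀ v ∈ R, v ≠ 0) (hneg : ∀ v ∈ R, -v ∈ R) :
    ∃ u v w : E, R = {u, -u, v, -v, w, -w} := by
  have : IsAddTorsionFree E := .of_isTorsionFree ℝ E
  have hself : ∀ v ∈ R, v ≠ -v := fun v hv h => h0 v hv (self_eq_neg.1 h)
  obtain ⟨u, hu⟩ : R.Nonempty := Finset.card_pos.1 (by omega)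
  have hcu : ({u, -u} : Finset E).card ≤ 2 := Finset.card_le_two
  obtain ⟨v, hv, hvu⟩ := Finset.exists_mem_notMem_of_card_lt_card
    (show ({u, -u} : Finset E).card < R.card by omega)
  have hcv : ({u, -u, v, -v} : Finset E).card ≤ 4 := Finset.card_le_four
  obtain ⟨w, hw, hwuv⟩ := Finset.exists_mem_notMem_of_card_lt_card
    (show ({u, -u, v, -v} : Finset E).card < R.card by omega)
  refine ⟨u, v, w, (Finset.eq_of_subset_of_card_le ?_ ?_).symm⟩
  · simp [Finset.insert_subset_iff, *]
  · have hu' := hself u hu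
    have hv' := hself v hv
    have hw' := hself w hw
    simp only [Finset.mem_insert, Finset.mem_singleton, not_or] at hvu hwuv
    obtain ⟨a1, a2⟩ := hvu
    obtain ⟨b1, b2, b3, b4⟩ := hwuv
    rw [hcard, Finset.card_insert_of_notMem, Finset.card_insert_of_notMem,
      Finset.card_insert_of_notMem, Finset.card_insert_of_notMem, Finset.card_insert_of_notMem,
      Finset.card_singleton]
    all_goals
      simp only [Finset.mem_insert, Finset.mem_singleton, not_or]
      grind

end PositiveSpanning

lemma unitSphere_subset_iUnion_iff (T : Finset (EuclideanSpace ℝ (Fin 3))) :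
    unitSphere ⊆ ⋃ v ∈ T, openHemisphere v ↔ PositivelySpans T := by
  constructor
  · intro h x hx
    have hmem : ‖x‖⁻¹ • x ∈ unitSphere := by simp [unitSphere, norm_smul, hx]
    obtain ⟨w, hw, -, hpos⟩ := Set.mem_iUnion₂.1 (h hmem)
    refine ⟨w, hw, ?_⟩
    rw [real_inner_smul_right] at hpos
    exact pos_of_mul_pos_right hpos (by positivity)
  · intro h x hx
    have hx0 : x ≠ 0 := by
      rintro rfl
      simp [unitSphere] at hx
    obtain ⟨w, hw, hpos⟩ := h x hx0
    exact Set.mem_iUnion₂.2 ⟨w, hw, hx, hpos⟩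

/-- A set of six open unit hemispheres covering `S²` is a minimal cover
(removing any member destroys the covering property) iff it consists of three
antipodal pairs of open unit hemispheres. -/
theorem six_hemisphere_cover_minimal_iff
    (R : Finset (EuclideanSpace ℝ (Fin 3))) (hR : ∀ v ∈ R, ‖v‖ = 1)
    (hcard : R.card = 6)
    (hcover : unitSphere ⊆ ⋃ v ∈ R, openHemisphere v) :
    (∀ s ∈ R, ¬ unitSphere ⊆ ⋃ v ∈ R.erase s, openHemisphere v) ↔
      ∃ u v w : EuclideanSpace ℝ (Fin 3), R = {u, -u, v, -v, w, -w} := by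
  simp only [unitSphere_subset_iUnion_iff] at hcover ⊢
  have hE : Module.finrank ℝ (EuclideanSpace ℝ (Fin 3)) = 3 := finrank_euclideanSpace_fin
  constructor
  · intro hmin
    refine exists_eq_three_pairs hcard (fun v hv h0 => ?_) fun v hv =>
      hcover.neg_mem hE hR (fun T hTR hT hspan => ?_) hv
    · simpa [h0] using hR v hv
    · obtain ⟨s, hs, hsT⟩ := Finset.exists_mem_notMem_of_card_lt_card
        (show T.card < R.card by omega)
      refine hmin s hs fun x hx => ?_
      obtain ⟨w, hw, hpos⟩ := hspan x hx
      exact ⟨w, Finset.mem_erase.2 ⟨fun h => hsT (h ▸ hw), hTR hw⟩, hpos⟩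
  · rintro ⟨u, v, w, rfl⟩ s hs
    simp only [Finset.mem_insert, Finset.mem_singleton] at hs
    obtain ⟨b, c, hbc⟩ : ∃ b c, ∀ x ∈ ({u, -u, v, -v, w, -w} : Finset _).erase s,
        x = -s ∨ x = b ∨ x = -b ∨ x = c ∨ x = -c := by
      simp only [Finset.mem_erase, Finset.mem_insert, Finset.mem_singleton]
      rcases hs with rfl | rfl | rfl | rfl | rfl | rfl
      · exact ⟨v, w, by tauto⟩
      · exact ⟨v, w, by rw [neg_neg]; tauto⟩
      · exact ⟨u, w, by tauto⟩
      · exact ⟨u, w, by rw [neg_neg]; tauto⟩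
      · exact ⟨u, v, by tauto⟩
      · exact ⟨u, v, by rw [neg_neg]; tauto⟩
    exact not_positivelySpans_of_subset hE (-s) b c hbc
end

section
/- Let S be a set of at least 7 distinct open unit hemispheres whose union covers the unit sphere S^2. Then there exists a subset R ⊂ S with |R| = 5 whose union covers S^2. -/
open scoped RealInnerProductSpace

open Finset

/-- A finite set of vectors is positively spanning if every nonzero vector has a positive inner
product with one of its members. -/
def PositivelySpanning {E : Type*} [NormedAddCommGroup E] [InnerProductSpace ℝ E]
    (S : Finset E) : Prop :=
  ∀ x : E, x ≠ 0 → ∃ v ∈ S, 0 < ⟪v, x⟫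

/-- Carathéodory's theorem for cones. -/
theorem exists_linearIndepOn_pos_sum_smul {𝕜 E : Type*} [Field 𝕜] [LinearOrder 𝕜]
    [IsStrictOrderedRing 𝕜] [AddCommGroup E] [Module 𝕜 E] (S : Finset E) (c : E → 𝕜)
    (hc : ∀ v ∈ S, 0 ≤ c v) :
    ∃ T ⊆ S, ∃ d : E → 𝕜, LinearIndepOn 𝕜 id (T : Set E) ∧ (∀ v ∈ T, 0 < d v) ∧
      ∑ v ∈ T, d v • v = ∑ v ∈ S, c v • v := by
  classical
  induction S using Finset.strongInduction generalizing c with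
  | H S ih =>
  have reduce (i : E) (hi : i ∈ S) (k : E → 𝕜) (hk : ∀ v ∈ S, 0 ≤ k v) (hki : k i = 0)
      (hsum : ∑ v ∈ S, k v • v = ∑ v ∈ S, c v • v) :
      ∃ T ⊆ S, ∃ d : E → 𝕜, LinearIndepOn 𝕜 id (T : Set E) ∧ (∀ v ∈ T, 0 < d v) ∧
        ∑ v ∈ T, d v • v = ∑ v ∈ S, c v • v := by
    obtain ⟨T, hT, d, hli, hd, hs⟩ :=
      ih (S.erase i) (erase_ssubset hi) k fun v hv => hk v (mem_of_mem_erase hv)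
    refine ⟨T, hT.trans (erase_subset _ _), d, hli, hd, ?_⟩
    rw [hs, sum_erase _ (by rw [hki, zero_smul]), hsum]
  by_cases hli : LinearIndepOn 𝕜 id (S : Set E)
  · by_cases hpos : ∀ v ∈ S, 0 < c v
    · exact ⟨S, Subset.rfl, c, hli, hpos, rfl⟩
    · push Not at hpos
      obtain ⟨i, hi, hle⟩ := hpos
      exact reduce i hi c hc (le_antisymm hle (hc i hi)) rfl
  · have hrel : ∃ g : E → 𝕜, ∑ v ∈ S, g v • v = 0 ∧ ∃ v ∈ S, 0 < g v := by
      rw [linearIndepOn_finset_iff] at hli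
      push Not at hli
      obtain ⟨g, hg, i, hi, hne⟩ := hli
      rcases lt_or_gt_of_ne hne with h | h
      · exact ⟨-g, by simpa using hg, i, hi, by simpa using h⟩
      · exact ⟨g, hg, i, hi, h⟩
    obtain ⟨g, hg, j, hj, hgj⟩ := hrel
    obtain ⟨i, hi, hmin⟩ := (S.filter (0 < g ·)).exists_min_image (fun v => c v / g v)
      ⟨j, mem_filter.2 ⟨hj, hgj⟩⟩
    obtain ⟨hiS, hgi⟩ := mem_filter.1 hi
    refine reduce i hiS (fun v => c v - c i / g i * g v) (fun v hv => ?_) ?_ ?_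
    · rw [sub_nonneg]
      by_cases hgv : 0 < g v
      · rw [← le_div_iff₀ hgv]
        exact hmin v (mem_filter.2 ⟨hv, hgv⟩)
      · exact (mul_nonpos_of_nonneg_of_nonpos (div_nonneg (hc i hiS) hgi.le)
          (not_lt.1 hgv)).trans (hc v hv)
    · field_simp
      simp
    · simp only [sub_smul, mul_smul, sum_sub_distrib, ← smul_sum, hg, smul_zero, sub_zero]

namespace PositivelySpanning

variable {E : Type*} [NormedAddCommGroup E] [InnerProductSpace ℝ E] {S : Finset E}

theorem of_forall_nonpos (h : ∀ x : E, (∀ v ∈ S, ⟪v, x⟫ ≤ 0) → x = 0) :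
    PositivelySpanning S := by
  intro x hx
  by_contra! hcon
  exact hx (h x hcon)

theorem span_eq_top [FiniteDimensional ℝ E] (h : PositivelySpanning S) :
    Submodule.span ℝ (S : Set E) = ⊤ := by
  rw [← Submodule.orthogonal_eq_bot_iff, Submodule.eq_bot_iff]
  intro x hx
  by_contra hne
  obtain ⟨v, hv, hpos⟩ := h x hne
  exact hpos.ne' ((Submodule.mem_orthogonal _ _).1 hx v (Submodule.subset_span hv))

/-- Every vector is a nonnegative combination of a positively spanning set. -/
theorem exists_nonneg_sum_smul [FiniteDimensional ℝ E] (h : PositivelySpanning S) (y : E) :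
    ∃ c : E → ℝ, (∀ v ∈ S, 0 ≤ c v) ∧ ∑ v ∈ S, c v • v = y := by
  classical
  rcases eq_or_ne y 0 with rfl | hy
  · exact ⟨0, by simp, by simp⟩
  have hSne : S.Nonempty := let ⟨v, hv, _⟩ := h y hy; ⟨v, hv⟩
  obtain ⟨m, hm, hmS⟩ : ∃ m > 0, ∀ x : E, ‖x‖ = 1 → ∃ v ∈ S, m ≤ ⟪v, x⟫ := by
    have hcont : Continuous fun x : E => S.sup' hSne fun v => ⟪v, x⟫ :=
      Continuous.finset_sup'_apply hSne fun v _ => by fun_prop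
    have hsph : (Metric.sphere (0 : E) 1).Nonempty :=
      ⟨‖y‖⁻¹ • y, by simp [norm_smul, hy]⟩
    obtain ⟨x₀, hx₀, hmin⟩ :=
      (isCompact_sphere (0 : E) 1).exists_isMinOn hsph hcont.continuousOn
    obtain ⟨v, hv, hpos⟩ := h x₀ (by rintro rfl; simp at hx₀)
    refine ⟨_, hpos.trans_le (le_sup' (fun v => ⟪v, x₀⟫) hv), fun x hx => ?_⟩
    obtain ⟨w, hw, hwx⟩ := S.exists_mem_eq_sup' hSne fun v => ⟪v, x⟫
    exact ⟨w, hw, hwx ▸ hmin (show x ∈ Metric.sphere 0 1 by simpa using hx)⟩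
  set r := m / ‖y‖ with hr
  have hypos : 0 < ‖y‖ := norm_pos_iff.2 hy
  have hrpos : 0 < r := div_pos hm hypos
  have hmem : r • y ∈ convexHull ℝ (S : Set E) := by
    by_contra hnot
    obtain ⟨f, u, hfS, hfy⟩ := geometric_hahn_banach_closed_point (convex_convexHull ℝ _)
      (S.finite_toSet.isClosed_convexHull ℝ) hnot
    obtain ⟨x, rfl⟩ := (InnerProductSpace.toDual ℝ E).surjective f
    simp only [InnerProductSpace.toDual_apply_apply] at hfS hfy
    have hlt (v) (hv : v ∈ S) : ⟪x, v⟫ < ⟪x, r • y⟫ :=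
      (hfS v (subset_convexHull ℝ _ hv)).trans hfy
    have hx : x ≠ 0 := by
      rintro rfl
      obtain ⟨v, hv⟩ := hSne
      simpa using hlt v hv
    have hxpos : 0 < ‖x‖ := norm_pos_iff.2 hx
    obtain ⟨v, hv, hmv⟩ := hmS (‖x‖⁻¹ • x) (by simp [norm_smul, hx])
    have h1 : m * ‖x‖ ≤ ⟪x, v⟫ := by
      rw [inner_smul_right, real_inner_comm, inv_mul_eq_div, le_div_iff₀ hxpos] at hmv
      exact hmv
    have h2 : ⟪x, r • y⟫ ≤ m * ‖x‖ := by
      refine (real_inner_le_norm _ _).trans_eq ?_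
      rw [norm_smul, Real.norm_of_nonneg hrpos.le, hr, div_mul_cancel₀ _ hypos.ne', mul_comm]
    linarith [hlt v hv]
  obtain ⟨w, hw, -, hsum⟩ := Finset.mem_convexHull'.1 hmem
  refine ⟨fun v => r⁻¹ * w v, fun v hv => mul_nonneg (inv_nonneg.2 hrpos.le) (hw v hv), ?_⟩
  simp only [mul_smul, ← smul_sum]
  rw [hsum, inv_smul_smul₀ hrpos.ne']

theorem mem_orthogonal_span {s : Set E} {x : E} (hx : ∀ v ∈ s, ⟪v, x⟫ = 0) :
    x ∈ (Submodule.span ℝ s)ᗮ := by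
  rw [Submodule.mem_orthogonal]
  intro u hu
  induction hu using Submodule.span_induction with
  | mem v hv => exact hx v hv
  | zero => simp
  | add a b _ _ ha hb => rw [inner_add_left, ha, hb, add_zero]
  | smul a b _ hb => rw [real_inner_smul_left, hb, mul_zero]

theorem eq_zero_of_inner_eq_zero {s : Set E} (hs : Submodule.span ℝ s = ⊤) {x : E}
    (hx : ∀ v ∈ s, ⟪v, x⟫ = 0) : x = 0 := by
  simpa [hs] using mem_orthogonal_span hx

/-- If `-v` is a strictly positive combination of `T`, then a vector with no positive inner product
with any element of `insert v T` is orthogonal to `T`. -/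
theorem inner_eq_zero_of_sum_smul_eq_neg {T : Finset E} {d : E → ℝ} {v x : E}
    (hd : ∀ t ∈ T, 0 < d t) (hsum : ∑ t ∈ T, d t • t = -v)
    (hv : ⟪v, x⟫ ≤ 0) (hT : ∀ t ∈ T, ⟪t, x⟫ ≤ 0) : ∀ t ∈ T, ⟪t, x⟫ = 0 := by
  have h1 : ∑ t ∈ T, d t * ⟪t, x⟫ = -⟪v, x⟫ := by
    rw [← inner_neg_left, ← hsum, sum_inner]
    simp [real_inner_smul_left]
  have h2 (t) (ht : t ∈ T) : d t * ⟪t, x⟫ ≤ 0 :=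
    mul_nonpos_of_nonneg_of_nonpos (hd t ht).le (hT t ht)
  have h3 := (sum_eq_zero_iff_of_nonpos h2).1
    (le_antisymm (sum_nonpos h2) (by rw [h1]; linarith))
  exact fun t ht => (mul_eq_zero.1 (h3 t ht)).resolve_left (hd t ht).ne'

/-- In dimension three, a positively spanning set of unit vectors containing a vector but not
its antipode has a positively spanning subset of size at most five. -/
theorem exists_card_le_five_of_neg_notMem (hE : Module.finrank ℝ E = 3)
    (h : PositivelySpanning S) (hS : ∀ v ∈ S, ‖v‖ = 1) {v : E} (hv : v ∈ S) (hneg : -v ∉ S) :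
    ∃ R ⊆ S, R.card ≤ 5 ∧ PositivelySpanning R := by
  classical
  have : FiniteDimensional ℝ E := Module.finite_of_finrank_pos (by omega)
  obtain ⟨c, hc, hcv⟩ := h.exists_nonneg_sum_smul (-v)
  obtain ⟨T, hTS, d, hli, hd, hsum⟩ := exists_linearIndepOn_pos_sum_smul S c hc
  rw [hcv] at hsum
  have hli' : LinearIndependent ℝ ((↑) : T → E) := hli
  have hspan : Module.finrank ℝ (Submodule.span ℝ (T : Set E)) = T.card := by
    simpa using finrank_span_finset_eq_card hli'
  have hle : T.card ≤ 3 := by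
    rw [← hspan, ← hE]
    exact Submodule.finrank_le _
  have hcases : T.card = 0 ∨ T.card = 1 ∨ T.card = 2 ∨ T.card = 3 := by omega
  rcases hcases with h0 | h1 | h2 | h3
  · rw [card_eq_zero] at h0
    have hv0 : v = 0 := by simpa [h0, eq_comm] using hsum
    simpa [hv0] using hS v hv
  · obtain ⟨t, rfl⟩ := card_eq_one.1 h1
    simp only [sum_singleton] at hsum
    have ht : t ∈ S := hTS (mem_singleton_self t)
    have hnorm := congrArg norm hsum
    rw [norm_smul, norm_neg, hS t ht, hS v hv, mul_one,
      Real.norm_of_nonneg (hd t (mem_singleton_self t)).le] at hnorm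
    rw [hnorm, one_smul] at hsum
    exact absurd (hsum ▸ ht) hneg
  · have horth : Module.finrank ℝ (Submodule.span ℝ (T : Set E))ᗮ = 1 := by
      have := Submodule.finrank_add_finrank_orthogonal (Submodule.span ℝ (T : Set E))
      omega
    obtain ⟨n, hn, hall⟩ := finrank_eq_one_iff'.1 horth
    have hn' : (n : E) ≠ 0 := by simpa using hn
    obtain ⟨p, hp, hpn⟩ := h n hn'
    obtain ⟨q, hq, hqn⟩ := h (-n) (neg_ne_zero.2 hn')
    rw [inner_neg_right] at hqn
    refine ⟨insert p (insert q (insert v T)), ?_, ?_, of_forall_nonpos fun x hx => ?_⟩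
    · simp only [insert_subset_iff]
      exact ⟨hp, hq, hv, hTS⟩
    · have h₁ := card_insert_le p (insert q (insert v T))
      have h₂ := card_insert_le q (insert v T)
      have h₃ := card_insert_le v T
      omega
    · simp only [mem_insert, forall_eq_or_imp] at hx
      obtain ⟨hpx, hqx, hvx, hTx⟩ := hx
      have hz := inner_eq_zero_of_sum_smul_eq_neg hd hsum hvx hTx
      have hxo : x ∈ (Submodule.span ℝ (T : Set E))ᗮ := mem_orthogonal_span hz
      obtain ⟨l, hl⟩ := hall ⟨x, hxo⟩
      have hlx : l • (n : E) = x := congrArg Subtype.val hl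
      rw [← hlx, inner_smul_right] at hpx hqx
      have hl0 : l = 0 := by
        apply le_antisymm
        · exact nonpos_of_mul_nonpos_left hpx hpn
        · by_contra! hneg
          nlinarith
      rw [← hlx, hl0, zero_smul]
  · refine ⟨insert v T, insert_subset_iff.2 ⟨hv, hTS⟩, (card_insert_le _ _).trans (by omega),
      of_forall_nonpos fun x hx => ?_⟩
    simp only [mem_insert, forall_eq_or_imp] at hx
    exact eq_zero_of_inner_eq_zero (Submodule.eq_top_of_finrank_eq (by rw [hspan, h3, hE]))
      (inner_eq_zero_of_sum_smul_eq_neg hd hsum hx.1 hx.2)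

/-- In dimension three, a centrally symmetric positively spanning set of at least seven unit
vectors has a positively spanning subset of size at most five. -/
theorem exists_card_le_five_of_neg_mem (hE : Module.finrank ℝ E = 3)
    (h : PositivelySpanning S) (hS : ∀ v ∈ S, ‖v‖ = 1) (hneg : ∀ v ∈ S, -v ∈ S)
    (hcard : 7 ≤ S.card) :
    ∃ R ⊆ S, R.card ≤ 5 ∧ PositivelySpanning R := by
  classical
  have : FiniteDimensional ℝ E := Module.finite_of_finrank_pos (by omega)
  obtain ⟨b, hbS, hbspan, hbli⟩ := exists_linearIndependent ℝ (S : Set E)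
  rw [h.span_eq_top] at hbspan
  lift b to Finset E using S.finite_toSet.subset hbS
  have hb3 : b.card = 3 := by
    have := finrank_span_finset_eq_card hbli
    rw [hbspan, finrank_top, hE] at this
    exact this.symm
  obtain ⟨w, hwS, hw⟩ : ∃ w ∈ S, w ∉ b ∪ b.image (-·) := by
    by_contra! hcon
    have h₁ := card_le_card (show S ⊆ b ∪ b.image (-·) from hcon)
    have h₂ := card_union_le b (b.image (-·))
    have h₃ : (b.image (-·)).card ≤ b.card := card_image_le
    omega
  obtain ⟨a, -, ha⟩ := Submodule.mem_span_finset.1 (show w ∈ Submodule.span ℝ (b : Set E) by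
    rw [hbspan]; trivial)
  have hw0 : w ≠ 0 := by
    rintro rfl
    simpa using hS 0 hwS
  set Z := b.filter (a · = 0)
  set P := b.filter (a · ≠ 0) with hP
  have hZP : Z.card + P.card = 3 := by rw [← hb3]; exact card_filter_add_card_filter_not _
  have haP : ∑ v ∈ P, a v • v = w := by
    rw [← ha]
    exact sum_filter_of_ne fun v _ hne hav => hne (by rw [hav, zero_smul])
  have hP2 : 2 ≤ P.card := by
    by_contra! hlt
    have hcases : P.card = 0 ∨ P.card = 1 := by omega
    rcases hcases with h0 | h1
    · rw [card_eq_zero] at h0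
      exact hw0 (by rw [← haP, h0, sum_empty])
    · obtain ⟨v, hv⟩ := card_eq_one.1 h1
      rw [hv, sum_singleton] at haP
      have hvb : v ∈ b := filter_subset _ b (by rw [← hP, hv]; exact mem_singleton_self v)
      have hnorm := congrArg norm haP
      rw [norm_smul, hS v (hbS hvb), hS w hwS, mul_one, Real.norm_eq_abs,
        abs_eq zero_le_one] at hnorm
      apply hw
      rcases hnorm with h1 | h1
      · rw [h1, one_smul] at haP
        exact mem_union_left _ (haP ▸ hvb)
      · rw [h1, neg_one_smul] at haP
        exact mem_union_right _ (mem_image.2 ⟨v, hvb, haP⟩)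
  let g : E → E := fun v => if 0 ≤ a v then v else -v
  have hgS (v) (hv : v ∈ b) : g v ∈ S := by
    dsimp only [g]
    split_ifs
    · exact hbS hv
    · exact hneg v (hbS hv)
  have hg (v) : |a v| • g v = a v • v := by
    dsimp only [g]
    split_ifs with hav
    · rw [abs_of_nonneg hav]
    · rw [abs_of_neg (not_le.1 hav), smul_neg, neg_smul, neg_neg]
  refine ⟨insert w (b.image (fun v => -g v) ∪ Z.image g), ?_, ?_, of_forall_nonpos fun x hx => ?_⟩
  · refine insert_subset_iff.2 ⟨hwS, union_subset ?_ ?_⟩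
    · exact image_subset_iff.2 fun v hv => hneg _ (hgS v hv)
    · exact image_subset_iff.2 fun v hv => hgS v (filter_subset _ _ hv)
  · have h₁ := card_insert_le w (b.image (fun v => -g v) ∪ Z.image g)
    have h₂ := card_union_le (b.image (fun v => -g v)) (Z.image g)
    have h₃ : (b.image (fun v => -g v)).card ≤ b.card := card_image_le
    have h₄ : (Z.image g).card ≤ Z.card := card_image_le
    omega
  · have hwx : ⟪w, x⟫ ≤ 0 := hx w (mem_insert_self _ _)
    have hgx (v) (hv : v ∈ b) : 0 ≤ ⟪g v, x⟫ := by
      have := hx (-g v) (mem_insert_of_mem (mem_union_left _ (mem_image_of_mem _ hv)))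
      rwa [inner_neg_left, neg_nonpos] at this
    have hZx (v) (hv : v ∈ Z) : ⟪g v, x⟫ ≤ 0 :=
      hx (g v) (mem_insert_of_mem (mem_union_right _ (mem_image_of_mem _ hv)))
    have hnn (v) (hv : v ∈ b) : 0 ≤ |a v| * ⟪g v, x⟫ := mul_nonneg (abs_nonneg _) (hgx v hv)
    have hsum : ∑ v ∈ b, |a v| * ⟪g v, x⟫ = ⟪w, x⟫ := by
      rw [← ha, sum_inner]
      exact sum_congr rfl fun v _ => by rw [← real_inner_smul_left, hg]
    have hz := (sum_eq_zero_iff_of_nonneg hnn).1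
      (le_antisymm (hsum.trans_le hwx) (sum_nonneg hnn))
    refine eq_zero_of_inner_eq_zero hbspan fun v hv => ?_
    have hgv : ⟪g v, x⟫ = 0 := by
      by_cases hav : a v = 0
      · exact le_antisymm (hZx v (mem_filter.2 ⟨hv, hav⟩)) (hgx v hv)
      · exact (mul_eq_zero.1 (hz v hv)).resolve_left (abs_ne_zero.2 hav)
    dsimp only [g] at hgv
    split_ifs at hgv
    · exact hgv
    · rwa [inner_neg_left, neg_eq_zero] at hgv

end PositivelySpanning

theorem positivelySpanning_iff_unitSphere_subset {S : Finset (EuclideanSpace ℝ (Fin 3))} :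
    PositivelySpanning S ↔ unitSphere ⊆ ⋃ v ∈ S, openHemisphere v := by
  constructor
  · intro h x hx
    obtain ⟨v, hv, hpos⟩ := h x (by rintro rfl; simp [unitSphere] at hx)
    exact Set.mem_biUnion hv ⟨hx, hpos⟩
  · intro h x hx
    have hmem : ‖x‖⁻¹ • x ∈ unitSphere := by simp [unitSphere, norm_smul, hx]
    obtain ⟨v, hv, -, hpos⟩ := Set.mem_iUnion₂.1 (h hmem)
    rw [inner_smul_right] at hpos
    exact ⟨v, hv, pos_of_mul_pos_right hpos (inv_nonneg.2 (norm_nonneg x))⟩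

/-- If at least seven distinct open unit hemispheres cover `S²`, then some
five of them already cover `S²`. -/
theorem five_of_seven_hemispheres_cover
    (S : Finset (EuclideanSpace ℝ (Fin 3))) (hS : ∀ v ∈ S, ‖v‖ = 1)
    (hcard : 7 ≤ S.card)
    (hcover : unitSphere ⊆ ⋃ v ∈ S, openHemisphere v) :
    ∃ R ⊆ S, R.card = 5 ∧ unitSphere ⊆ ⋃ v ∈ R, openHemisphere v := by
  have hE : Module.finrank ℝ (EuclideanSpace ℝ (Fin 3)) = 3 := finrank_euclideanSpace_fin
  have h := positivelySpanning_iff_unitSphere_subset.2 hcover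
  obtain ⟨R, hRS, hR5, hR⟩ : ∃ R ⊆ S, R.card ≤ 5 ∧ PositivelySpanning R := by
    by_cases hneg : ∀ v ∈ S, -v ∈ S
    · exact h.exists_card_le_five_of_neg_mem hE hS hneg hcard
    · push Not at hneg
      obtain ⟨v, hv, hnv⟩ := hneg
      exact h.exists_card_le_five_of_neg_notMem hE hS hv hnv
  obtain ⟨Q, hRQ, hQS, hQ⟩ := exists_subsuperset_card_eq hRS hR5 (by omega)
  refine ⟨Q, hQS, hQ, positivelySpanning_iff_unitSphere_subset.1 fun x hx => ?_⟩
  obtain ⟨v, hv, hpos⟩ := hR x hx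
  exact ⟨v, hRQ hv, hpos⟩
end

section
/- The genus of the complete bipartite graph K_{m,n} equals ⌈(m−2)(n−2)/4⌉ for m, n ≥ 2. -/
/-- The reversal of darts of a simple graph, as a permutation. -/
def dartRev {V : Type*} (G : SimpleGraph V) : Equiv.Perm G.Dart :=
  ⟨SimpleGraph.Dart.symm, SimpleGraph.Dart.symm,
    fun d => SimpleGraph.Dart.symm_symm d, fun d => SimpleGraph.Dart.symm_symm d⟩

/-- A rotation system (combinatorial embedding into an orientable surface) of a
simple graph: a permutation of the darts that fixes initial vertices and is a
single cycle on the darts emanating from each vertex. -/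
structure RotationSystem {V : Type*} (G : SimpleGraph V) where
  rot : Equiv.Perm G.Dart
  fst_rot : ∀ d : G.Dart, (rot d).toProd.1 = d.toProd.1
  cyclic : ∀ d d' : G.Dart, d.toProd.1 = d'.toProd.1 → rot.SameCycle d d'

/-- The number of faces of a rotation system: the number of orbits of the face
permutation `rot ∘ rev`. -/
noncomputable def RotationSystem.numFaces {V : Type*} {G : SimpleGraph V}
    (ρ : RotationSystem G) : ℕ :=
  Nat.card (Quotient (MulAction.orbitRel
    (Subgroup.zpowers ((dartRev G).trans ρ.rot)) G.Dart))

/-- A (connected) graph `G` embeds cellularly in the orientable closed surface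
of genus `g` iff it has a rotation system whose Euler characteristic equals
`2 - 2g`, i.e. `V - E + F = 2 - 2g` where `2E` is the number of darts. -/
def SimpleGraph.EmbedsInGenus {V : Type*} (G : SimpleGraph V) (g : ℕ) : Prop :=
  ∃ ρ : RotationSystem G,
    2 * Nat.card V + 2 * ρ.numFaces + 4 * g = Nat.card G.Dart + 4

/-- The orientable genus of a graph: the minimum genus of an orientable closed
surface in which the graph embeds. -/
noncomputable def graphGenus {V : Type*} (G : SimpleGraph V) : ℕ :=
  sInf {g | G.EmbedsInGenus g}

open Function

/-- The number of cycles of a self-map of a finite type all of whose points are periodic, counted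
by weighting each point with the inverse of the length of its cycle. -/
noncomputable def cycleCount {α : Type*} [Fintype α] (f : α → α) : ℚ :=
  ∑ x, (minimalPeriod f x : ℚ)⁻¹

theorem Function.Semiconj.minimalPeriod_eq {α β : Type*} {i : α → β} {f : α → α} {g : β → β}
    (h : Semiconj i f g) (hi : Injective i) (x : α) :
    minimalPeriod g (i x) = minimalPeriod f x := by
  rw [minimalPeriod_eq_minimalPeriod_iff]
  intro n
  rw [IsPeriodicPt, IsFixedPt, ← (h.iterate_right n).eq x, hi.eq_iff]
  rfl

theorem card_orbitRel_zpowers_eq_cycleCount {α : Type*} [Fintype α] (f : Equiv.Perm α) :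
    (Nat.card (Quotient (MulAction.orbitRel (Subgroup.zpowers f) α)) : ℚ) = cycleCount f := by
  classical
  rw [Nat.card_eq_fintype_card, ← Finset.card_univ, Finset.cast_card, cycleCount,
    ← Finset.sum_fiberwise (s := Finset.univ)
      (g := fun x => (Quotient.mk (MulAction.orbitRel (Subgroup.zpowers f) α) x))]
  refine Finset.sum_congr rfl fun q _ => ?_
  induction q using Quotient.inductionOn with | _ x => ?_
  have key : ∀ y, (Quotient.mk (MulAction.orbitRel (Subgroup.zpowers f) α) y) = Quotient.mk _ x ↔
      y ∈ MulAction.orbit (Subgroup.zpowers f) x := fun y => Quotient.eq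
  have hper : ∀ y, minimalPeriod f y = Fintype.card (MulAction.orbit (Subgroup.zpowers f) y) :=
    fun y => MulAction.minimalPeriod_eq_card (a := f) (b := y)
  rw [Finset.sum_congr rfl (g := fun _ =>
    (Fintype.card (MulAction.orbit (Subgroup.zpowers f) x) : ℚ)⁻¹)]
  · rw [Finset.sum_const, nsmul_eq_mul, Finset.filter_congr fun y _ => key y,
      ← Fintype.card_subtype]
    refine (mul_inv_cancel₀ ?_).symm
    have : Nonempty (MulAction.orbit (Subgroup.zpowers f) x) := ⟨⟨x, MulAction.mem_orbit_self x⟩⟩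
    exact_mod_cast Fintype.card_ne_zero
  · intro y hy
    rw [Finset.mem_filter, key] at hy
    rw [hper y]
    congr 2
    have := MulAction.orbit_eq_iff.2 hy.2
    simp only [this]

theorem Equiv.Perm.mem_periodicPts {α : Type*} [Finite α] (f : Equiv.Perm α) (x : α) :
    x ∈ periodicPts f :=
  Function.Injective.mem_periodicPts f.injective x

theorem Equiv.Perm.minimalPeriod_pos {α : Type*} [Finite α] (f : Equiv.Perm α) (x : α) :
    0 < minimalPeriod f x :=
  minimalPeriod_pos_of_mem_periodicPts (f.mem_periodicPts x)

theorem cycleCount_congr {α β : Type*} [Fintype α] [Fintype β] (e : α ≃ β) {f : α → α} {g : β → β}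
    (h : Semiconj e f g) : cycleCount f = cycleCount g :=
  Fintype.sum_equiv e _ _ fun x => by rw [h.minimalPeriod_eq e.injective]

theorem minimalPeriod_eq_two {α : Type*} {f : α → α} {x : α} (h : f (f x) = x) (h' : f x ≠ x) :
    minimalPeriod f x = 2 :=
  haveI := Fact.mk Nat.prime_two
  minimalPeriod_eq_prime_iff.2 ⟨h, h'⟩

/-- Extending a self-map by a fixed-point free involution. -/
theorem cycleCount_of_semiconj {α β : Type*} [Fintype α] [Fintype β] {i : α → β} {f : α → α}
    {g : β → β} (h : Semiconj i f g) (hi : Injective i) (hg : ∀ z, z ∉ Set.range i → g (g z) = z)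
    (hg' : ∀ z, g z ≠ z) :
    cycleCount g = cycleCount f + (Fintype.card β - Fintype.card α) / 2 := by
  classical
  rw [cycleCount, cycleCount, ← Finset.sum_add_sum_compl (Finset.univ.image i),
    Finset.sum_image hi.injOn]
  congr 1
  · exact Finset.sum_congr rfl fun x _ => by rw [h.minimalPeriod_eq hi]
  · rw [Finset.sum_congr rfl (g := fun _ => (2 : ℚ)⁻¹), Finset.sum_const, nsmul_eq_mul,
      Finset.card_compl, Finset.card_image_of_injective _ hi, Finset.card_univ,
      Nat.cast_sub (Fintype.card_le_of_injective i hi), div_eq_mul_inv]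
    intro z hz
    rw [minimalPeriod_eq_two (hg z (by simpa using hz)) (hg' z)]
    norm_num

/-- An equivalence relation containing all steps of a cyclic permutation but one is trivial. -/
theorem rel_of_forall_sameCycle {α : Type*} [Finite α] {f : Equiv.Perm α}
    (hf : ∀ x y, f.SameCycle x y) {r : α → α → Prop} (hr : Equivalence r) {v : α}
    (h : ∀ u, u ≠ v → r u (f u)) (x : α) : r v x := by
  have key : ∀ k, r (f v) ((f ^ (k + 1)) v) := by
    intro k
    induction k with
    | zero => exact hr.refl _
    | succ k ih =>
      rw [pow_succ' f (k + 1), Equiv.Perm.mul_apply]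
      by_cases hv : (f ^ (k + 1)) v = v
      · rw [hv]; exact hr.refl _
      · exact hr.trans ih (h _ hv)
  have all : ∀ y, r (f v) y := by
    intro y
    obtain ⟨k, hk, -, rfl⟩ := (hf v y).exists_pow_eq''
    obtain ⟨k, rfl⟩ := Nat.exists_eq_succ_of_ne_zero hk.ne'
    exact key k
  exact hr.trans (hr.symm (all v)) (all x)

/-- A rotation system of the complete bipartite graph with parts `α` and `β`: a cyclic permutation
of `α` for each element of `β` and vice versa. -/
structure BipartiteRotation (α β : Type*) where
  left : β → Equiv.Perm α
  right : α → Equiv.Perm β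
  left_cyclic : ∀ b x y, (left b).SameCycle x y
  right_cyclic : ∀ a x y, (right a).SameCycle x y

namespace BipartiteRotation

variable {α β α' β' : Type*}

/-- The permutation of the darts from `α` to `β` that moves each dart two steps along its face. -/
def face (P : BipartiteRotation α β) (p : α × β) : α × β :=
  (P.left p.2 p.1, P.right (P.left p.2 p.1) p.2)

/-- All faces are quadrilaterals. -/
def IsQuadrangular (P : BipartiteRotation α β) : Prop :=
  ∀ p, P.face (P.face p) = p

theorem left_ne [Nontrivial α] (P : BipartiteRotation α β) (b : β) (a : α) : P.left b a ≠ a := by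
  intro h
  obtain ⟨a', ha'⟩ := exists_ne a
  exact ha' ((Equiv.Perm.SameCycle.eq_of_left (P.left_cyclic b a a') h).symm)

theorem face_ne [Nontrivial α] (P : BipartiteRotation α β) (p : α × β) : P.face p ≠ p :=
  fun h => P.left_ne p.2 p.1 (congrArg Prod.fst h)

/-- Transport of rotations along bijections of the parts. -/
def congr (P : BipartiteRotation α β) (e : α ≃ α') (f : β ≃ β') : BipartiteRotation α' β' where
  left b := e.permCongr (P.left (f.symm b))
  right a := f.permCongr (P.right (e.symm a))
  left_cyclic b x y := by
    have := (P.left_cyclic (f.symm b) (e.symm x) (e.symm y))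
    obtain ⟨k, hk⟩ := this
    refine ⟨k, ?_⟩
    rw [← Equiv.permCongrHom_coe e, ← map_zpow]
    simp [hk]
  right_cyclic a x y := by
    obtain ⟨k, hk⟩ := (P.right_cyclic (e.symm a) (f.symm x) (f.symm y))
    refine ⟨k, ?_⟩
    rw [← Equiv.permCongrHom_coe f, ← map_zpow]
    simp [hk]

theorem semiconj_congr (P : BipartiteRotation α β) (e : α ≃ α') (f : β ≃ β') :
    Semiconj (e.prodCongr f) P.face (P.congr e f).face := by
  rintro ⟨a, b⟩
  simp [face, congr]

theorem IsQuadrangular.congr {P : BipartiteRotation α β} (hP : P.IsQuadrangular) (e : α ≃ α')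
    (f : β ≃ β') : (P.congr e f).IsQuadrangular := by
  intro p
  obtain ⟨p, rfl⟩ := (e.prodCongr f).surjective p
  rw [← (P.semiconj_congr e f).eq, ← (P.semiconj_congr e f).eq, hP]

theorem cycleCount_congr [Fintype α] [Fintype β] [Fintype α'] [Fintype β']
    (P : BipartiteRotation α β) (e : α ≃ α') (f : β ≃ β') :
    cycleCount (P.congr e f).face = cycleCount P.face :=
  (_root_.cycleCount_congr _ (P.semiconj_congr e f)).symm

/-- Exchange of the two parts. -/
def swap (P : BipartiteRotation α β) : BipartiteRotation β α where
  left := P.right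
  right := P.left
  left_cyclic := P.right_cyclic
  right_cyclic := P.left_cyclic

/-- The bijection taking a dart from `α` to `β` to its successor on its face, reversed. -/
def leftEquiv (P : BipartiteRotation α β) : α × β ≃ β × α where
  toFun p := (p.2, P.left p.2 p.1)
  invFun p := ((P.left p.1).symm p.2, p.1)
  left_inv p := by simp
  right_inv p := by simp

theorem semiconj_swap (P : BipartiteRotation α β) :
    Semiconj P.leftEquiv P.face P.swap.face := by
  rintro ⟨a, b⟩
  simp [face, swap, leftEquiv]

theorem IsQuadrangular.swap {P : BipartiteRotation α β} (hP : P.IsQuadrangular) :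
    P.swap.IsQuadrangular := by
  intro p
  obtain ⟨p, rfl⟩ := P.leftEquiv.surjective p
  rw [← P.semiconj_swap.eq, ← P.semiconj_swap.eq, hP]

theorem cycleCount_swap [Fintype α] [Fintype β] (P : BipartiteRotation α β) :
    cycleCount P.swap.face = cycleCount P.face :=
  (_root_.cycleCount_congr _ P.semiconj_swap).symm

end BipartiteRotation

section Splice

variable {X Y : Type*}

/-- The map on `X ⊕ Y` that follows `s` on `X` and `t` on `Y`, where a step to the extra point of
one side is replaced by a step from the extra point of the other side. The point `z` is a junk
value. -/
def spliceFun (s : Option X → Option X) (t : Option Y → Option Y) : X ⊕ Y → X ⊕ Y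
  | .inl x => match s (some x), t none with
    | some x', _ => .inl x'
    | none, some y => .inr y
    | none, none => .inl x
  | .inr y => match t (some y), s none with
    | some y', _ => .inr y'
    | none, some x => .inl x
    | none, none => .inr y

variable {s : Option X → Option X} {t : Option Y → Option Y}

theorem spliceFun_inl {x x' : X} (h : s (some x) = some x') :
    spliceFun s t (.inl x) = .inl x' := by
  simp [spliceFun, h]

theorem spliceFun_inr {y y' : Y} (h : t (some y) = some y') :
    spliceFun s t (.inr y) = .inr y' := by
  simp [spliceFun, h]

theorem spliceFun_inl_of_eq_none {x : X} {y : Y} (h : s (some x) = none) (h' : t none = some y) :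
    spliceFun s t (.inl x) = .inr y := by
  simp [spliceFun, h, h']

theorem spliceFun_inr_of_eq_none {x : X} {y : Y} (h : t (some y) = none) (h' : s none = some x) :
    spliceFun s t (.inr y) = .inl x := by
  simp [spliceFun, h, h']

theorem spliceFun_leftInverse {s' : Option X → Option X} {t' : Option Y → Option Y}
    (hs : LeftInverse s' s) (ht : LeftInverse t' t) (hs₀ : s none ≠ none) (ht₀ : t none ≠ none) :
    LeftInverse (spliceFun s' t') (spliceFun s t) := by
  obtain ⟨x₀, hx₀⟩ := Option.ne_none_iff_exists'.1 hs₀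
  obtain ⟨y₀, hy₀⟩ := Option.ne_none_iff_exists'.1 ht₀
  have hx₀' : s' (some x₀) = none := by rw [← hx₀, hs]
  have hy₀' : t' (some y₀) = none := by rw [← hy₀, ht]
  rintro (x | y)
  · rcases h : s (some x) with _ | x'
    · rw [spliceFun_inl_of_eq_none h hy₀, spliceFun_inr_of_eq_none hy₀' (by rw [← h, hs])]
    · rw [spliceFun_inl h, spliceFun_inl (x' := x) (by rw [← h, hs])]
  · rcases h : t (some y) with _ | y'
    · rw [spliceFun_inr_of_eq_none h hx₀, spliceFun_inl_of_eq_none hx₀' (by rw [← h, ht])]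
    · rw [spliceFun_inr h, spliceFun_inr (y' := y) (by rw [← h, ht])]

/-- Splicing two permutations at their extra points. -/
def splice (s : Equiv.Perm (Option X)) (t : Equiv.Perm (Option Y)) (hs : s none ≠ none)
    (ht : t none ≠ none) : Equiv.Perm (X ⊕ Y) where
  toFun := spliceFun s t
  invFun := spliceFun s.symm t.symm
  left_inv := spliceFun_leftInverse s.left_inv t.left_inv hs ht
  right_inv := spliceFun_leftInverse s.right_inv t.right_inv
    (fun h => hs (by rw [Equiv.symm_apply_eq] at h; exact h.symm))
    (fun h => ht (by rw [Equiv.symm_apply_eq] at h; exact h.symm))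

theorem splice_sameCycle [Finite X] [Finite Y] {s : Equiv.Perm (Option X)}
    {t : Equiv.Perm (Option Y)} (hs : s none ≠ none) (ht : t none ≠ none)
    (hsc : ∀ x y, s.SameCycle x y) (htc : ∀ x y, t.SameCycle x y) (x y : X ⊕ Y) :
    (splice s t hs ht).SameCycle x y := by
  obtain ⟨x₀, hx₀⟩ := Option.ne_none_iff_exists'.1 hs
  obtain ⟨y₀, hy₀⟩ := Option.ne_none_iff_exists'.1 ht
  have step : ∀ z, (splice s t hs ht).SameCycle z (splice s t hs ht z) := fun z =>
    Equiv.Perm.sameCycle_apply_right.2 (Equiv.Perm.SameCycle.refl _ _)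
  have hX : ∀ u : Option X, (splice s t hs ht).SameCycle (.inr y₀)
      (u.elim (.inr y₀) .inl) := by
    refine rel_of_forall_sameCycle hsc (v := none)
      (r := fun u v => (splice s t hs ht).SameCycle (u.elim (.inr y₀) .inl) (v.elim (.inr y₀) .inl))
      ⟨fun _ => .refl _ _, fun h => h.symm, fun h h' => h.trans h'⟩ ?_
    rintro (_ | x) hu
    · exact absurd rfl hu
    · suffices h : (s (some x)).elim (.inr y₀) .inl = splice s t hs ht (.inl x) from
        h ▸ step (.inl x)
      rcases h : s (some x) with _ | x'
      · exact (spliceFun_inl_of_eq_none h hy₀).symm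
      · exact (spliceFun_inl h).symm
  have hY : ∀ u : Option Y, (splice s t hs ht).SameCycle (.inl x₀)
      (u.elim (.inl x₀) .inr) := by
    refine rel_of_forall_sameCycle htc (v := none)
      (r := fun u v => (splice s t hs ht).SameCycle (u.elim (.inl x₀) .inr) (v.elim (.inl x₀) .inr))
      ⟨fun _ => .refl _ _, fun h => h.symm, fun h h' => h.trans h'⟩ ?_
    rintro (_ | y) hu
    · exact absurd rfl hu
    · suffices h : (t (some y)).elim (.inl x₀) .inr = splice s t hs ht (.inr y) from
        h ▸ step (.inr y)
      rcases h : t (some y) with _ | y'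
      · exact (spliceFun_inr_of_eq_none h hx₀).symm
      · exact (spliceFun_inr h).symm
  have all : ∀ z, (splice s t hs ht).SameCycle (.inl x₀) z := by
    rintro (x | y)
    · exact (hX (some x₀)).symm.trans (hX (some x))
    · exact hY (some y)
  exact (all x).symm.trans (all y)

end Splice

namespace BipartiteRotation

variable {X Y β : Type*} [Finite X] [Finite Y] [Nonempty X] [Nonempty Y]

/-- The diamond sum of two rotation systems: the extra vertices `none` are removed, and the
rotations at the vertices of `β` are spliced. -/
def diamondSum (P : BipartiteRotation (Option X) β) (Q : BipartiteRotation (Option Y) β) :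
    BipartiteRotation (X ⊕ Y) β where
  left b := splice (P.left b) (Q.left b) (P.left_ne b none) (Q.left_ne b none)
  right := Sum.elim (fun x => P.right (some x)) (fun y => Q.right (some y))
  left_cyclic b := splice_sameCycle _ _ (P.left_cyclic b) (Q.left_cyclic b)
  right_cyclic := by
    rintro (x | y)
    · exact P.right_cyclic _
    · exact Q.right_cyclic _

variable {P : BipartiteRotation (Option X) β} {Q : BipartiteRotation (Option Y) β}

theorem diamondSum_face_inl {x x' : X} {b b' : β} (h : P.face (some x, b) = (some x', b')) :
    (P.diamondSum Q).face (.inl x, b) = (.inl x', b') := by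
  obtain ⟨h₁, h₂⟩ := Prod.ext_iff.1 h
  simp only [face] at h₁ h₂
  have : (P.diamondSum Q).left b (.inl x) = .inl x' := spliceFun_inl h₁
  rw [face]
  simp only [this]
  rw [h₁] at h₂
  exact Prod.ext rfl h₂

theorem diamondSum_face_inr {y y' : Y} {b b' : β} (h : Q.face (some y, b) = (some y', b')) :
    (P.diamondSum Q).face (.inr y, b) = (.inr y', b') := by
  obtain ⟨h₁, h₂⟩ := Prod.ext_iff.1 h
  simp only [face] at h₁ h₂
  have : (P.diamondSum Q).left b (.inr y) = .inr y' := spliceFun_inr h₁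
  rw [face]
  simp only [this]
  rw [h₁] at h₂
  exact Prod.ext rfl h₂

theorem diamondSum_face_inl_of_eq_none {x : X} {y : Y} {b b' c : β}
    (h : P.face (some x, b) = (none, c)) (h' : Q.face (none, b) = (some y, b')) :
    (P.diamondSum Q).face (.inl x, b) = (.inr y, b') := by
  obtain ⟨h₁, h₂⟩ := Prod.ext_iff.1 h
  obtain ⟨h₃, h₄⟩ := Prod.ext_iff.1 h'
  simp only [face] at h₁ h₂ h₃ h₄
  have : (P.diamondSum Q).left b (.inl x) = .inr y := spliceFun_inl_of_eq_none h₁ h₃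
  rw [face]
  simp only [this]
  rw [h₃] at h₄
  exact Prod.ext rfl h₄

theorem diamondSum_face_inr_of_eq_none {x : X} {y : Y} {b b' c : β}
    (h : Q.face (some y, b) = (none, c)) (h' : P.face (none, b) = (some x, b')) :
    (P.diamondSum Q).face (.inr y, b) = (.inl x, b') := by
  obtain ⟨h₁, h₂⟩ := Prod.ext_iff.1 h
  obtain ⟨h₃, h₄⟩ := Prod.ext_iff.1 h'
  simp only [face] at h₁ h₂ h₃ h₄
  have : (P.diamondSum Q).left b (.inr y) = .inl x := spliceFun_inr_of_eq_none h₁ h₃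
  rw [face]
  simp only [this]
  rw [h₃] at h₄
  exact Prod.ext rfl h₄

/-- If `Q` is quadrangular and aligned with `P`, then the face permutation of the diamond sum
extends that of `P` by a fixed-point free involution. -/
theorem exists_semiconj_diamondSum (hQ : Q.IsQuadrangular)
    (h : ∀ b, Q.right none (P.right none b) = b) :
    ∃ i : Option X × β → (X ⊕ Y) × β, Injective i ∧ Semiconj i P.face (P.diamondSum Q).face ∧
      ∀ z, z ∉ Set.range i → (P.diamondSum Q).face ((P.diamondSum Q).face z) = z := by
  have hnone : ∀ b, ∃ y, Q.face (none, b) = (some y, P.right none b) ∧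
      Q.face (some y, P.right none b) = (none, b) := by
    intro b
    obtain ⟨y, hy⟩ := Option.ne_none_iff_exists'.1 (Q.left_ne b none)
    have h₁ : Q.face (none, b) = (some y, Q.right (some y) b) := by simp [face, hy]
    have h₂ := hQ (none, b)
    rw [h₁] at h₂
    obtain ⟨h₃, h₄⟩ := Prod.ext_iff.1 h₂
    simp only [face] at h₃ h₄
    rw [h₃, ← h b, (Q.right none).injective.eq_iff, h b] at h₄
    rw [h₄] at h₁ h₂
    exact ⟨y, h₁, h₂⟩
  choose y hy hy' using hnone
  have hy₁ : ∀ b, Q.face (none, (P.right none).symm b) = (some (y ((P.right none).symm b)), b) := by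
    intro b
    simpa using hy ((P.right none).symm b)
  have hy₂ : ∀ b, Q.face (some (y ((P.right none).symm b)), b) = (none, (P.right none).symm b) := by
    intro b
    simpa using hy' ((P.right none).symm b)
  refine ⟨fun p => (p.1.elim (.inr (y ((P.right none).symm p.2))) .inl, p.2), ?_, ?_, ?_⟩
  · rintro ⟨_ | x, b⟩ ⟨_ | x', b'⟩ hp <;> simp_all
  · rintro ⟨_ | x, b⟩
    · obtain ⟨x, hx⟩ := Option.ne_none_iff_exists'.1 (P.left_ne b none)
      have h₁ : P.face (none, b) = (some x, P.right (some x) b) := by simp [face, hx]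
      rw [h₁]
      exact (diamondSum_face_inr_of_eq_none (hy₂ b) h₁).symm
    · rcases h₁ : P.face (some x, b) with ⟨_ | x', c⟩
      · have h₂ : c = P.right none b := by
          obtain ⟨h₃, h₄⟩ := Prod.ext_iff.1 h₁
          simp only [face] at h₃ h₄
          rw [← h₄, h₃]
        subst h₂
        simpa using (diamondSum_face_inl_of_eq_none h₁ (hy b)).symm
      · exact (diamondSum_face_inl h₁).symm
  · rintro ⟨x | z, b⟩ hz
    · exact absurd ⟨(some x, b), rfl⟩ hz
    · rcases h₁ : Q.face (some z, b) with ⟨_ | z', c⟩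
      · have h₂ := hQ (some z, b)
        have h₃ : c = (P.right none).symm b := by
          obtain ⟨h₃, h₄⟩ := Prod.ext_iff.1 h₁
          simp only [face] at h₃ h₄
          rw [← h₄, h₃, Equiv.eq_symm_apply, ← (Q.right none).injective.eq_iff, h]
        rw [h₁, h₃, hy₁] at h₂
        simp only [Prod.mk.injEq, Option.some.injEq, and_true] at h₂
        exact absurd ⟨(none, b), by simp [h₂]⟩ hz
      · have h₂ := hQ (some z, b)
        rw [h₁] at h₂
        rw [diamondSum_face_inr h₁, diamondSum_face_inr h₂]

theorem cycleCount_diamondSum [Fintype X] [Fintype Y] [Fintype β] (hQ : Q.IsQuadrangular)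
    (h : ∀ b, Q.right none (P.right none b) = b) :
    cycleCount (P.diamondSum Q).face =
      cycleCount P.face + (Fintype.card Y - 1) * Fintype.card β / 2 := by
  obtain ⟨i, hi, hi', hi''⟩ := exists_semiconj_diamondSum hQ h
  have : Nontrivial (X ⊕ Y) :=
    ⟨.inl (Classical.arbitrary X), .inr (Classical.arbitrary Y), Sum.inl_ne_inr⟩
  rw [cycleCount_of_semiconj hi' hi hi'' (P.diamondSum Q).face_ne]
  simp only [Fintype.card_prod, Fintype.card_sum, Fintype.card_option]
  push_cast
  ring

theorem IsQuadrangular.diamondSum (hP : P.IsQuadrangular) (hQ : Q.IsQuadrangular)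
    (h : ∀ b, Q.right none (P.right none b) = b) : (P.diamondSum Q).IsQuadrangular := by
  obtain ⟨i, hi, hi', hi''⟩ := exists_semiconj_diamondSum hQ h
  intro z
  by_cases hz : z ∈ Set.range i
  · obtain ⟨p, rfl⟩ := hz
    rw [← hi'.eq, ← hi'.eq, hP]
  · exact hi'' z hz

end BipartiteRotation

namespace BipartiteRotation

theorem isCycle_right {α β : Type*} [Nontrivial β] (P : BipartiteRotation α β) (a : α) :
    (P.right a).IsCycle :=
  ⟨Classical.arbitrary β, P.swap.left_ne a _, fun _ _ => P.right_cyclic a _ _⟩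

theorem support_right {α β : Type*} [Nontrivial β] [Fintype β] [DecidableEq β]
    (P : BipartiteRotation α β) (a : α) : (P.right a).support = Finset.univ :=
  Finset.eq_univ_of_forall fun b => Equiv.Perm.mem_support.2 (P.swap.left_ne a b)

/-- Any two rotations can be aligned at two given vertices. -/
theorem exists_right_congr_right {α α' β : Type*} [Nontrivial β] [Finite β]
    (P : BipartiteRotation α β) (Q : BipartiteRotation α' β) (a : α) (a' : α') :
    ∃ f : Equiv.Perm β, ∀ b, (Q.congr (Equiv.refl _) f).right a' (P.right a b) = b := by
  classical
  have := Fintype.ofFinite β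
  have hconj : IsConj (Q.right a') (P.right a)⁻¹ :=
    (Q.isCycle_right a').isConj (P.isCycle_right a).inv
      (by rw [Equiv.Perm.support_inv, support_right, support_right])
  obtain ⟨f, hf⟩ := isConj_iff.1 hconj
  refine ⟨f, fun b => ?_⟩
  have h : (Q.congr (Equiv.refl _) f).right a' = f * Q.right a' * f⁻¹ := rfl
  rw [h, hf]
  simp

theorem exists_diamondSum {k l n : ℕ} (hk : k ≠ 0) (hl : l ≠ 0) (hn : 2 ≤ n)
    (P : BipartiteRotation (Fin (k + 1)) (Fin n)) (Q : BipartiteRotation (Fin (l + 1)) (Fin n))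
    (hQ : Q.IsQuadrangular) :
    ∃ D : BipartiteRotation (Fin (k + l)) (Fin n),
      cycleCount D.face = cycleCount P.face + (l - 1) * n / 2 ∧
        (P.IsQuadrangular → D.IsQuadrangular) := by
  have : NeZero k := ⟨hk⟩
  have : NeZero l := ⟨hl⟩
  have : Nontrivial (Fin n) := Fin.nontrivial_iff_two_le.2 hn
  let P' := P.congr (finSuccEquiv k) (Equiv.refl _)
  let Q₀ := Q.congr (finSuccEquiv l) (Equiv.refl _)
  obtain ⟨f, hf⟩ := exists_right_congr_right P' Q₀ none none
  have hQ' : (Q₀.congr (Equiv.refl _) f).IsQuadrangular := (hQ.congr _ _).congr _ _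
  refine ⟨(P'.diamondSum (Q₀.congr (Equiv.refl _) f)).congr finSumFinEquiv (Equiv.refl _), ?_,
    fun hP => ((hP.congr _ _).diamondSum hQ' hf).congr _ _⟩
  rw [cycleCount_congr, cycleCount_diamondSum hQ' hf, cycleCount_congr]
  simp

theorem bijective_of_forall_exists_iterate {α : Type*} [Finite α] {f : α → α} {N : ℕ}
    (h : ∀ x y, ∃ k < N, f^[k] x = y) : Bijective f := by
  refine Finite.surjective_iff_bijective.1 fun y => ?_
  obtain ⟨k, -, hk⟩ := h (f y) y
  exact ⟨f^[k] y, by rwa [← iterate_succ_apply' f k y, iterate_succ_apply]⟩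

theorem sameCycle_ofBijective {α : Type*} [Finite α] {f : α → α} {N : ℕ}
    (h : ∀ x y, ∃ k < N, f^[k] x = y) (x y : α) :
    Equiv.Perm.SameCycle (Equiv.ofBijective f (bijective_of_forall_exists_iterate h)) x y := by
  obtain ⟨k, -, hk⟩ := h x y
  exact ⟨k, by rw [zpow_natCast, ← Equiv.Perm.iterate_eq_pow]; exact hk⟩

/-- The rotation with given successor functions. -/
noncomputable def ofFun {α β : Type*} [Finite α] [Finite β] (s : β → α → α) (t : α → β → β)
    {M N : ℕ} (hs : ∀ b x y, ∃ k < M, (s b)^[k] x = y) (ht : ∀ a x y, ∃ k < N, (t a)^[k] x = y) :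
    BipartiteRotation α β where
  left b := Equiv.ofBijective (s b) (bijective_of_forall_exists_iterate (hs b))
  right a := Equiv.ofBijective (t a) (bijective_of_forall_exists_iterate (ht a))
  left_cyclic b := sameCycle_ofBijective (hs b)
  right_cyclic a := sameCycle_ofBijective (ht a)

/-- The existence of a rotation of `K_{m,n}` with all faces quadrilaterals. -/
def ExistsQuadrangular (m n : ℕ) : Prop :=
  ∃ P : BipartiteRotation (Fin m) (Fin n), P.IsQuadrangular

/-- The existence of a rotation of `K_{m,n}` of genus `⌈(m - 2) (n - 2) / 4⌉`, expressed by the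
number of its faces. -/
def ExistsMinimal (m n : ℕ) : Prop :=
  ∃ P : BipartiteRotation (Fin m) (Fin n),
    cycleCount P.face + m + n + 2 * (((m - 2) * (n - 2) + 3) / 4 : ℕ) = m * n + 2

theorem ExistsQuadrangular.swap {m n : ℕ} (h : ExistsQuadrangular m n) :
    ExistsQuadrangular n m :=
  h.imp' _ fun _ hP => hP.swap

theorem ExistsMinimal.swap {m n : ℕ} (h : ExistsMinimal m n) : ExistsMinimal n m := by
  obtain ⟨P, hP⟩ := h
  refine ⟨P.swap, ?_⟩
  rw [cycleCount_swap, mul_comm (n - 2), mul_comm (n : ℚ), ← hP]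
  ring

theorem ExistsMinimal.add_four {m n : ℕ} (hm : 2 ≤ m) (hn : 2 ≤ n) (h : ExistsMinimal m n)
    (hq : ExistsQuadrangular 6 n) : ExistsMinimal (m + 4) n := by
  obtain ⟨k, rfl⟩ := Nat.exists_eq_add_of_le' hm
  obtain ⟨l, rfl⟩ := Nat.exists_eq_add_of_le' hn
  obtain ⟨P, hP⟩ := h
  obtain ⟨Q, hQ⟩ := hq
  obtain ⟨D, hD, -⟩ := exists_diamondSum (k := k + 1) (l := 5) (by simp) (by simp) hn P Q hQ
  refine ⟨D, ?_⟩
  rw [hD]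
  have h₁ : ((k + 2 + 4 - 2) * (l + 2 - 2) + 3) / 4 =
      ((k + 2 - 2) * (l + 2 - 2) + 3) / 4 + l := by
    rw [show k + 2 + 4 - 2 = k + 4 by omega, Nat.add_sub_cancel, Nat.add_sub_cancel, add_mul]
    omega
  rw [h₁]
  generalize ((k + 2 - 2) * (l + 2 - 2) + 3) / 4 = g at hP ⊢
  push_cast at hP ⊢
  linear_combination hP

theorem existsQuadrangular_two_six : ExistsQuadrangular 2 6 :=
  ⟨ofFun ![![1, 0], ![1, 0], ![1, 0], ![1, 0], ![1, 0], ![1, 0]]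
    ![![3, 2, 5, 4, 1, 0], ![5, 4, 1, 0, 3, 2]]
    (M := 6) (N := 6) (by decide) (by decide), by
    change ∀ p, _ = p
    decide +kernel⟩

theorem existsQuadrangular_three_six : ExistsQuadrangular 3 6 :=
  ⟨ofFun ![![1, 2, 0], ![1, 2, 0], ![1, 2, 0], ![2, 0, 1], ![2, 0, 1], ![2, 0, 1]]
    ![![5, 4, 3, 0, 2, 1], ![3, 5, 4, 1, 0, 2], ![4, 3, 5, 2, 1, 0]]
    (M := 6) (N := 6) (by decide) (by decide), by
    change ∀ p, _ = p
    decide +kernel⟩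

theorem existsQuadrangular_six {m : ℕ} (hm : 2 ≤ m) : ExistsQuadrangular m 6 := by
  induction m, hm using Nat.le_induction with
  | base => exact existsQuadrangular_two_six
  | succ m hm ih =>
    obtain ⟨k, rfl⟩ := Nat.exists_eq_add_of_le' hm
    obtain ⟨P, hP⟩ := ih
    obtain ⟨Q, hQ⟩ := existsQuadrangular_three_six
    obtain ⟨D, -, hD⟩ := exists_diamondSum (k := k + 1) (l := 2) (by simp) (by simp) (by simp) P Q hQ
    exact ⟨D, hD hP⟩

theorem minimalPeriod_eq_of_forall_ne {α : Type*} {f : α → α} {x : α} {p : ℕ} (hp : 0 < p)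
    (h : f^[p] x = x) (h' : ∀ j < p, 0 < j → f^[j] x ≠ x) : minimalPeriod f x = p := by
  refine (IsPeriodicPt.minimalPeriod_le hp h).antisymm (not_lt.1 fun hlt => ?_)
  exact h' _ hlt (IsPeriodicPt.minimalPeriod_pos hp h) (iterate_minimalPeriod)

/-- A criterion for explicit rotations, where `p` gives the lengths of the face cycles. -/
theorem existsMinimal_of_fun {m n : ℕ} (s : Fin n → Fin m → Fin m) (t : Fin m → Fin n → Fin n)
    (p : Fin m → Fin n → ℕ) (hs : ∀ b x y, ∃ k < m, (s b)^[k] x = y)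
    (ht : ∀ a x y, ∃ k < n, (t a)^[k] x = y)
    (hp : ∀ a b, 0 < p a b ∧ p a b ∣ 60 ∧
      (fun q : Fin m × Fin n => (s q.2 q.1, t (s q.2 q.1) q.2))^[p a b] (a, b) = (a, b) ∧
      ∀ j < p a b, 0 < j →
        (fun q : Fin m × Fin n => (s q.2 q.1, t (s q.2 q.1) q.2))^[j] (a, b) ≠ (a, b))
    (hsum : ∑ a, ∑ b, 60 / p a b + 60 * (m + n + 2 * (((m - 2) * (n - 2) + 3) / 4)) =
      60 * (m * n + 2)) :
    ExistsMinimal m n := by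
  refine ⟨ofFun s t hs ht, ?_⟩
  have h : ∀ a b, (minimalPeriod (ofFun s t hs ht).face (a, b) : ℚ)⁻¹ =
      ((60 / p a b : ℕ) : ℚ) / 60 := by
    intro a b
    obtain ⟨h₀, h₁, h₂, h₃⟩ := hp a b
    have : (p a b : ℚ) ≠ 0 := by exact_mod_cast h₀.ne'
    rw [minimalPeriod_eq_of_forall_ne (f := (ofFun s t hs ht).face) h₀ h₂ h₃, Nat.cast_div h₁ this]
    push_cast
    field_simp
  rw [cycleCount, Fintype.sum_prod_type]
  simp only [h]
  simp only [← Finset.sum_div, ← Nat.cast_sum]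
  have := congrArg (Nat.cast : ℕ → ℚ) hsum
  generalize ∑ a, ∑ b, 60 / p a b = S at this ⊢
  generalize ((m - 2) * (n - 2) + 3) / 4 = g at this ⊢
  push_cast at this ⊢
  linear_combination this / 60

theorem existsMinimal_two_two : ExistsMinimal 2 2 :=
  existsMinimal_of_fun
    ![![1, 0], ![1, 0]]
    ![![1, 0], ![1, 0]]
    ![![2, 2], ![2, 2]]
    (by decide) (by decide) (by decide +kernel) (by decide +kernel)

theorem existsMinimal_two_three : ExistsMinimal 2 3 :=
  existsMinimal_of_fun
    ![![1, 0], ![1, 0], ![1, 0]]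
    ![![1, 2, 0], ![2, 0, 1]]
    ![![2, 2, 2], ![2, 2, 2]]
    (by decide) (by decide) (by decide +kernel) (by decide +kernel)

theorem existsMinimal_two_four : ExistsMinimal 2 4 :=
  existsMinimal_of_fun
    ![![1, 0], ![1, 0], ![1, 0], ![1, 0]]
    ![![2, 0, 3, 1], ![1, 3, 0, 2]]
    ![![2, 2, 2, 2], ![2, 2, 2, 2]]
    (by decide) (by decide) (by decide +kernel) (by decide +kernel)

theorem existsMinimal_two_five : ExistsMinimal 2 5 :=
  existsMinimal_of_fun
    ![![1, 0], ![1, 0], ![1, 0], ![1, 0], ![1, 0]]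
    ![![2, 3, 1, 4, 0], ![4, 2, 0, 1, 3]]
    ![![2, 2, 2, 2, 2], ![2, 2, 2, 2, 2]]
    (by decide) (by decide) (by decide +kernel) (by decide +kernel)

theorem existsMinimal_three_three : ExistsMinimal 3 3 :=
  existsMinimal_of_fun
    ![![2, 0, 1], ![1, 2, 0], ![2, 0, 1]]
    ![![1, 2, 0], ![2, 0, 1], ![1, 2, 0]]
    ![![5, 2, 5], ![2, 2, 5], ![5, 5, 2]]
    (by decide) (by decide) (by decide +kernel) (by decide +kernel)

theorem existsMinimal_three_four : ExistsMinimal 3 4 :=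
  existsMinimal_of_fun
    ![![1, 2, 0], ![1, 2, 0], ![1, 2, 0], ![2, 0, 1]]
    ![![2, 0, 3, 1], ![2, 3, 1, 0], ![3, 0, 1, 2]]
    ![![3, 2, 3, 2], ![2, 3, 3, 2], ![3, 3, 2, 2]]
    (by decide) (by decide) (by decide +kernel) (by decide +kernel)

theorem existsMinimal_three_five : ExistsMinimal 3 5 :=
  existsMinimal_of_fun
    ![![1, 2, 0], ![1, 2, 0], ![2, 0, 1], ![2, 0, 1], ![2, 0, 1]]
    ![![2, 3, 1, 4, 0], ![4, 2, 3, 0, 1], ![3, 4, 0, 1, 2]]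
    ![![2, 2, 2, 2, 3], ![2, 2, 2, 3, 2], ![2, 2, 3, 2, 2]]
    (by decide) (by decide) (by decide +kernel) (by decide +kernel)

theorem existsMinimal_four_four : ExistsMinimal 4 4 :=
  existsMinimal_of_fun
    ![![1, 2, 3, 0], ![1, 2, 3, 0], ![3, 0, 1, 2], ![3, 0, 1, 2]]
    ![![2, 3, 1, 0], ![3, 2, 0, 1], ![2, 3, 1, 0], ![3, 2, 0, 1]]
    ![![2, 2, 2, 2], ![2, 2, 2, 2], ![2, 2, 2, 2], ![2, 2, 2, 2]]
    (by decide) (by decide) (by decide +kernel) (by decide +kernel)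

theorem existsMinimal_four_five : ExistsMinimal 4 5 :=
  existsMinimal_of_fun
    ![![2, 3, 1, 0], ![3, 2, 0, 1], ![1, 2, 3, 0], ![3, 2, 0, 1], ![3, 0, 1, 2]]
    ![![4, 3, 1, 0, 2], ![2, 0, 4, 1, 3], ![3, 2, 0, 4, 1], ![1, 2, 3, 4, 0]]
    ![![2, 2, 2, 3, 2], ![2, 3, 2, 2, 2], ![2, 3, 3, 2, 2], ![2, 2, 2, 3, 3]]
    (by decide) (by decide) (by decide +kernel) (by decide +kernel)

theorem existsMinimal_five_five : ExistsMinimal 5 5 :=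
  existsMinimal_of_fun
    ![![3, 2, 0, 4, 1], ![1, 4, 3, 0, 2], ![4, 2, 3, 0, 1], ![4, 0, 1, 2, 3], ![3, 0, 4, 2, 1]]
    ![![3, 4, 0, 1, 2], ![4, 3, 1, 0, 2], ![3, 4, 0, 1, 2], ![2, 3, 4, 0, 1], ![3, 2, 0, 4, 1]]
    ![![2, 2, 3, 4, 2], ![2, 2, 4, 2, 3], ![4, 2, 2, 2, 2], ![2, 2, 2, 2, 2], ![3, 2, 2, 2, 4]]
    (by decide) (by decide) (by decide +kernel) (by decide +kernel)

theorem existsMinimal_of_le_five {m n : ℕ} (hm : 2 ≤ m) (hm' : m ≤ 5) (hn : 2 ≤ n) (hn' : n ≤ 5) :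
    ExistsMinimal m n := by
  wlog h : m ≤ n generalizing m n
  · exact (this hn hn' hm hm' (by omega)).swap
  interval_cases m <;> interval_cases n <;> first
    | omega
    | exact existsMinimal_two_two
    | exact existsMinimal_two_three
    | exact existsMinimal_two_four
    | exact existsMinimal_two_five
    | exact existsMinimal_three_three
    | exact existsMinimal_three_four
    | exact existsMinimal_three_five
    | exact existsMinimal_four_four
    | exact existsMinimal_four_five
    | exact existsMinimal_five_five

theorem existsMinimal_of_forall_le_five {n : ℕ} (hn : 2 ≤ n)
    (h : ∀ m, 2 ≤ m → m ≤ 5 → ExistsMinimal m n) {m : ℕ} (hm : 2 ≤ m) : ExistsMinimal m n := by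
  induction m using Nat.strong_induction_on with
  | _ m ih =>
    rcases le_or_gt m 5 with hm' | hm'
    · exact h m hm hm'
    · obtain ⟨k, rfl⟩ := Nat.exists_eq_add_of_le' (show 4 ≤ m by omega)
      exact (ih k (by omega) (by omega)).add_four (by omega) hn (existsQuadrangular_six hn).swap

theorem existsMinimal {m n : ℕ} (hm : 2 ≤ m) (hn : 2 ≤ n) : ExistsMinimal m n :=
  existsMinimal_of_forall_le_five hn (fun _ hk hk' => (existsMinimal_of_forall_le_five hk
    (fun _ hl hl' => existsMinimal_of_le_five hl hl' hk hk') hn).swap) hm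

end BipartiteRotation

theorem Equiv.Perm.SameCycle.map_of_semiconj {α β : Type*} [Finite α] {f : Equiv.Perm α}
    {g : Equiv.Perm β} {i : α → β} (h : Semiconj i f g) {x y : α} (hxy : f.SameCycle x y) :
    g.SameCycle (i x) (i y) := by
  obtain ⟨k, rfl⟩ := hxy.exists_nat_pow_eq
  refine ⟨k, ?_⟩
  rw [zpow_natCast, ← Equiv.Perm.iterate_eq_pow, ← Equiv.Perm.iterate_eq_pow]
  exact ((h.iterate_right k).eq x).symm

section Alternating

variable {α : Type*} (f g : α → α)

/-- The self-map of `α ⊕ α` that alternates between the two summands. -/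
def alternate : α ⊕ α → α ⊕ α := Sum.elim (fun x => .inr (f x)) (fun x => .inl (g x))

theorem alternate_iterate_two_mul (k : ℕ) (x : α) :
    (alternate f g)^[2 * k] (.inl x) = .inl ((g ∘ f)^[k] x) := by
  induction k generalizing x with
  | zero => rfl
  | succ k ih => exact ih _

theorem minimalPeriod_alternate_inl (x : α) :
    minimalPeriod (alternate f g) (.inl x) = 2 * minimalPeriod (g ∘ f) x := by
  refine Nat.dvd_antisymm ?_ ?_
  · rw [← isPeriodicPt_iff_minimalPeriod_dvd, IsPeriodicPt, IsFixedPt, alternate_iterate_two_mul,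
      iterate_minimalPeriod]
  · have h := isPeriodicPt_minimalPeriod (alternate f g) (.inl x)
    rcases Nat.even_or_odd' (minimalPeriod (alternate f g) (.inl x)) with ⟨k, hk | hk⟩ <;>
      rw [hk, IsPeriodicPt, IsFixedPt] at h <;> rw [hk]
    · rw [alternate_iterate_two_mul, Sum.inl.injEq] at h
      exact mul_dvd_mul_left 2 (isPeriodicPt_iff_minimalPeriod_dvd.1 h)
    · rw [iterate_succ_apply', alternate_iterate_two_mul] at h
      exact absurd h Sum.inr_ne_inl

theorem alternate_injective {f g : α → α} (hf : Injective f) (hg : Injective g) :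
    Injective (alternate f g) := by
  rintro (x | x) (y | y) h <;> simp_all [alternate, hf.eq_iff, hg.eq_iff]

theorem cycleCount_alternate [Fintype α] (f g : Equiv.Perm α) :
    cycleCount (alternate f g) = cycleCount (g ∘ f) := by
  have h : ∀ x, minimalPeriod (alternate f g) (.inr (f x)) = 2 * minimalPeriod (g ∘ f) x := by
    intro x
    rw [← minimalPeriod_alternate_inl, ← minimalPeriod_apply
      ((alternate_injective f.injective g.injective).mem_periodicPts (.inl x))]
    rfl
  simp only [cycleCount, Fintype.sum_sum_type]
  rw [← Equiv.sum_comp f fun x => (minimalPeriod (alternate f g) (.inr x) : ℚ)⁻¹,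
    ← Finset.sum_add_distrib]
  refine Finset.sum_congr rfl fun x _ => ?_
  rw [h, minimalPeriod_alternate_inl]
  push_cast
  rw [mul_inv]
  ring

end Alternating

section CompleteBipartite

variable (α β : Type*)

/-- The darts of a complete bipartite graph. -/
noncomputable def completeBipartiteGraphDartEquiv :
    (α × β) ⊕ (α × β) ≃ (completeBipartiteGraph α β).Dart :=
  Equiv.ofBijective
    (Sum.elim (fun p => ⟨(.inl p.1, .inr p.2), by simp⟩) (fun p => ⟨(.inr p.2, .inl p.1), by simp⟩))
    ⟨by rintro (⟨a, b⟩ | ⟨a, b⟩) (⟨a', b'⟩ | ⟨a', b'⟩) h <;> simp_all [SimpleGraph.Dart.ext_iff], by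
      rintro ⟨⟨a | b, a' | b'⟩, h⟩
      · simp at h
      · exact ⟨.inl (a, b'), rfl⟩
      · exact ⟨.inr (a', b), rfl⟩
      · simp at h⟩

theorem card_dart_completeBipartiteGraph [Finite α] [Finite β] :
    Nat.card (completeBipartiteGraph α β).Dart = 2 * (Nat.card α * Nat.card β) := by
  rw [← Nat.card_congr (completeBipartiteGraphDartEquiv α β), Nat.card_sum, Nat.card_prod, two_mul]

variable {α β}

/-- The rotation system on the graph `K_{α,β}` given by a bipartite rotation. -/
noncomputable def BipartiteRotation.toRotationSystem [Finite α] [Finite β]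
    (P : BipartiteRotation α β) : RotationSystem (completeBipartiteGraph α β) where
  rot := (completeBipartiteGraphDartEquiv α β).permCongr
    (Equiv.sumCongr (Equiv.prodCongrRight P.right) (Equiv.prodCongrLeft P.left))
  fst_rot d := by
    obtain ⟨⟨a, b⟩ | ⟨a, b⟩, rfl⟩ := (completeBipartiteGraphDartEquiv α β).surjective d <;>
    · rw [Equiv.permCongr_apply, Equiv.symm_apply_apply]
      rfl
  cyclic d d' h := by
    obtain ⟨⟨a, b⟩ | ⟨a, b⟩, rfl⟩ := (completeBipartiteGraphDartEquiv α β).surjective d <;>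
    obtain ⟨⟨a', b'⟩ | ⟨a', b'⟩, rfl⟩ := (completeBipartiteGraphDartEquiv α β).surjective d'
    · obtain rfl : a = a' := Sum.inl_injective h
      refine (P.right_cyclic a b b').map_of_semiconj
        (i := fun b => completeBipartiteGraphDartEquiv α β (.inl (a, b))) fun b => ?_
      rw [Equiv.permCongr_apply, Equiv.symm_apply_apply]
      rfl
    · exact absurd h Sum.inl_ne_inr
    · exact absurd h Sum.inr_ne_inl
    · obtain rfl : b = b' := Sum.inr_injective h
      refine (P.left_cyclic b a a').map_of_semiconj
        (i := fun a => completeBipartiteGraphDartEquiv α β (.inr (a, b))) fun a => ?_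
      rw [Equiv.permCongr_apply, Equiv.symm_apply_apply]
      rfl

theorem BipartiteRotation.numFaces_toRotationSystem [Fintype α] [Fintype β]
    (P : BipartiteRotation α β) : (P.toRotationSystem.numFaces : ℚ) = cycleCount P.face := by
  have := Fintype.ofEquiv _ (completeBipartiteGraphDartEquiv α β)
  have h : Semiconj (completeBipartiteGraphDartEquiv α β)
      (alternate (Equiv.prodCongrLeft P.left) (Equiv.prodCongrRight P.right))
      ((dartRev _).trans P.toRotationSystem.rot) := by
    rintro (⟨a, b⟩ | ⟨a, b⟩)
    · change _ = P.toRotationSystem.rot (completeBipartiteGraphDartEquiv α β (.inr (a, b)))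
      rw [toRotationSystem, Equiv.permCongr_apply, Equiv.symm_apply_apply]
      rfl
    · change _ = P.toRotationSystem.rot (completeBipartiteGraphDartEquiv α β (.inl (a, b)))
      rw [toRotationSystem, Equiv.permCongr_apply, Equiv.symm_apply_apply]
      rfl
  rw [RotationSystem.numFaces, card_orbitRel_zpowers_eq_cycleCount, ← _root_.cycleCount_congr _ h,
    cycleCount_alternate]
  rfl

end CompleteBipartite

section LowerBound

variable {V : Type*} {G : SimpleGraph V}

theorem RotationSystem.fst_face (ρ : RotationSystem G) (d : G.Dart) :
    ((dartRev G).trans ρ.rot d).fst = d.snd :=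
  ρ.fst_rot d.symm

/-- In a bipartite graph without vertices of degree one, all faces have length at least four. -/
theorem RotationSystem.four_le_minimalPeriod [Finite G.Dart] (ρ : RotationSystem G)
    (c : G.Coloring Bool) (hG : ∀ d : G.Dart, ∃ d' : G.Dart, d'.fst = d.fst ∧ d' ≠ d) (d : G.Dart) :
    4 ≤ minimalPeriod ((dartRev G).trans ρ.rot) d := by
  have hpos := Equiv.Perm.minimalPeriod_pos ((dartRev G).trans ρ.rot) d
  have hper := iterate_minimalPeriod (f := (dartRev G).trans ρ.rot) (x := d)
  have hfst := ρ.fst_face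
  have hc : ∀ d, c ((dartRev G).trans ρ.rot d).fst = !c d.fst := by
    intro d
    rw [hfst d, Bool.eq_not_iff]
    exact c.valid d.adj.symm
  have hrot : ∀ d, (dartRev G).trans ρ.rot d = ρ.rot d.symm := fun _ => rfl
  generalize (dartRev G).trans ρ.rot = φ at *
  by_contra! hlt
  interval_cases hk : minimalPeriod φ d
  · have := hc d
    rw [show φ d = d from hper] at this
    simp at this
  · have h₁ : φ (φ d) = d := hper
    have h₂ : φ d = d.symm := by
      refine SimpleGraph.Dart.ext _ _ (Prod.ext (hfst d) ?_)
      have := hfst (φ d)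
      rw [h₁] at this
      exact this.symm
    obtain ⟨d', hd', hne⟩ := hG d.symm
    rw [hrot] at h₂
    exact hne ((ρ.cyclic _ _ hd'.symm).eq_of_left h₂).symm
  · have h₁ : φ (φ (φ d)) = d := hper
    have h₂ := hc (φ (φ d))
    rw [h₁, hc, hc] at h₂
    simp at h₂

theorem RotationSystem.four_mul_numFaces_le [Finite G.Dart] (ρ : RotationSystem G)
    (c : G.Coloring Bool) (hG : ∀ d : G.Dart, ∃ d' : G.Dart, d'.fst = d.fst ∧ d' ≠ d) :
    4 * ρ.numFaces ≤ Nat.card G.Dart := by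
  have := Fintype.ofFinite G.Dart
  have h : (ρ.numFaces : ℚ) ≤ Nat.card G.Dart * 4⁻¹ := by
    rw [RotationSystem.numFaces, card_orbitRel_zpowers_eq_cycleCount, Nat.card_eq_fintype_card,
      ← Finset.card_univ, ← nsmul_eq_mul, cycleCount]
    refine Finset.sum_le_card_nsmul _ _ _ fun d _ => ?_
    exact inv_anti₀ (by norm_num) (by exact_mod_cast ρ.four_le_minimalPeriod c hG d)
  have h' : (4 * ρ.numFaces : ℚ) ≤ Nat.card G.Dart := by linarith
  exact_mod_cast h'

end LowerBound

theorem exists_dart_ne_completeBipartiteGraph {α β : Type*} [Nontrivial α] [Nontrivial β]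
    (d : (completeBipartiteGraph α β).Dart) :
    ∃ d' : (completeBipartiteGraph α β).Dart, d'.fst = d.fst ∧ d' ≠ d := by
  obtain ⟨⟨a, b⟩ | ⟨a, b⟩, rfl⟩ := (completeBipartiteGraphDartEquiv α β).surjective d
  · obtain ⟨b', hb'⟩ := exists_ne b
    exact ⟨completeBipartiteGraphDartEquiv α β (.inl (a, b')), rfl, by simpa using hb'⟩
  · obtain ⟨a', ha'⟩ := exists_ne a
    exact ⟨completeBipartiteGraphDartEquiv α β (.inr (a', b)), rfl, by simpa using ha'⟩

/-- The genus of the complete bipartite graph `K_{m,n}` is `⌈(m−2)(n−2)/4⌉`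
for `m, n ≥ 2` (here written with natural subtraction and division, so that
`((m−2)(n−2)+3)/4 = ⌈(m−2)(n−2)/4⌉`). -/
theorem genus_completeBipartiteGraph (m n : ℕ) (hm : 2 ≤ m) (hn : 2 ≤ n) :
    graphGenus (completeBipartiteGraph (Fin m) (Fin n)) =
      ((m - 2) * (n - 2) + 3) / 4 := by
  have hcard := card_dart_completeBipartiteGraph (Fin m) (Fin n)
  have hV : Nat.card (Fin m ⊕ Fin n) = m + n := by simp
  simp only [Nat.card_eq_fintype_card, Fintype.card_fin] at hcard
  have hmem : (completeBipartiteGraph (Fin m) (Fin n)).EmbedsInGenus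
      (((m - 2) * (n - 2) + 3) / 4) := by
    obtain ⟨P, hP⟩ := BipartiteRotation.existsMinimal hm hn
    refine ⟨P.toRotationSystem, ?_⟩
    rw [← P.numFaces_toRotationSystem] at hP
    rw [hV, hcard]
    have hP' : P.toRotationSystem.numFaces + m + n + 2 * (((m - 2) * (n - 2) + 3) / 4) =
      m * n + 2 := by exact_mod_cast hP
    omega
  refine le_antisymm (Nat.sInf_le hmem) (le_csInf ⟨_, hmem⟩ ?_)
  rintro g ⟨ρ, hρ⟩
  have : Nontrivial (Fin m) := Fin.nontrivial_iff_two_le.2 hm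
  have : Nontrivial (Fin n) := Fin.nontrivial_iff_two_le.2 hn
  have : Finite (completeBipartiteGraph (Fin m) (Fin n)).Dart :=
    Finite.of_equiv _ (completeBipartiteGraphDartEquiv (Fin m) (Fin n))
  have hF := ρ.four_mul_numFaces_le (SimpleGraph.CompleteBipartiteGraph.bicoloring _ _)
    exists_dart_ne_completeBipartiteGraph
  rw [hV] at hρ
  obtain ⟨k, rfl⟩ := Nat.exists_eq_add_of_le' hm
  obtain ⟨l, rfl⟩ := Nat.exists_eq_add_of_le' hn
  have hkl : (k + 2) * (l + 2) = k * l + 2 * k + 2 * l + 4 := by ring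
  rw [Nat.add_sub_cancel, Nat.add_sub_cancel]
  omega
end

section
/- In particular, the genus of K_{3,b} is ⌈(b−2)/4⌉ for b ≥ 2; consequently, if K_{3,b} embeds in an orientable surface of genus g, then b ≤ 4g + 2. -/
namespace RotationSystem

variable {V : Type*} {G : SimpleGraph V}

/-- The face permutation `rot ∘ rev` of a rotation system. -/
def face (ρ : RotationSystem G) : Equiv.Perm G.Dart :=
  (dartRev G).trans ρ.rot

theorem face_apply (ρ : RotationSystem G) (d : G.Dart) : ρ.face d = ρ.rot d.symm := rfl

theorem face_fst (ρ : RotationSystem G) (d : G.Dart) : (ρ.face d).toProd.1 = d.toProd.2 :=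
  ρ.fst_rot d.symm

theorem mk_eq_mk_iff_sameCycle (ρ : RotationSystem G) (d d' : G.Dart) :
    (Quotient.mk (MulAction.orbitRel (Subgroup.zpowers ρ.face) G.Dart) d =
      Quotient.mk _ d') ↔ ρ.face.SameCycle d d' := by
  rw [Quotient.eq, MulAction.orbitRel_apply, Equiv.Perm.sameCycle_comm]
  constructor
  · rintro ⟨⟨_, k, rfl⟩, h⟩
    exact ⟨k, h⟩
  · rintro ⟨k, h⟩
    exact ⟨⟨_, k, rfl⟩, h⟩

/-- A surjective labelling of the darts whose fibres are the cycles of the face permutation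
counts the faces. -/
theorem numFaces_eq_card (ρ : RotationSystem G) {Q : Type*} (q : G.Dart → Q)
    (hq : Function.Surjective q) (hface : ∀ d, q (ρ.face d) = q d)
    (hcycle : ∀ d d', q d = q d' → ρ.face.SameCycle d d') : ρ.numFaces = Nat.card Q := by
  have hpow : ∀ (k : ℤ) d, q ((ρ.face ^ k) d) = q d := by
    intro k
    induction k with
    | zero => simp
    | succ k ih => intro d; rw [zpow_add_one, Equiv.Perm.mul_apply, ih, hface]
    | pred k ih =>
      intro d
      rw [zpow_sub_one, Equiv.Perm.mul_apply, ih, ← hface]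
      simp
  refine Nat.card_congr (Equiv.ofBijective (Quotient.lift q ?_) ⟨?_, ?_⟩)
  · intro d d' h
    obtain ⟨k, rfl⟩ := (ρ.mk_eq_mk_iff_sameCycle d d').1 (Quotient.sound h)
    exact (hpow k d).symm
  · rintro ⟨d⟩ ⟨d'⟩ h
    exact (ρ.mk_eq_mk_iff_sameCycle d d').2 (hcycle d d' h)
  · intro x
    obtain ⟨d, rfl⟩ := hq x
    exact ⟨Quotient.mk _ d, rfl⟩

/-- If no face has length less than `n`, the number of faces times `n` is at most the number
of darts. -/
theorem numFaces_mul_le [Finite G.Dart] (ρ : RotationSystem G) (n : ℕ)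
    (h : ∀ d : G.Dart, ∀ k, 0 < k → k < n → (ρ.face ^ k) d ≠ d) :
    ρ.numFaces * n ≤ Nat.card G.Dart := by
  rw [numFaces, ← Nat.card_fin n, ← Nat.card_prod]
  refine Nat.card_le_card_of_injective (fun x => (ρ.face ^ (x.2 : ℕ)) x.1.out) ?_
  have aux : ∀ (d : G.Dart) (i j : Fin n), (ρ.face ^ (i : ℕ)) d = (ρ.face ^ (j : ℕ)) d →
      i ≤ j → i = j := by
    intro d i j hij hle
    by_contra hne
    have hlt : (i : ℕ) < j := lt_of_le_of_ne hle (fun h => hne (Fin.ext h))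
    refine h d (j - i) (by omega) (by omega) ((ρ.face ^ (i : ℕ)).injective ?_)
    rw [← Equiv.Perm.mul_apply, ← pow_add, hij]
    congr 2
    omega
  rintro ⟨o, i⟩ ⟨o', j⟩ hij
  simp only at hij
  have ho : o = o' := by
    rw [← o.out_eq, ← o'.out_eq]
    refine (ρ.mk_eq_mk_iff_sameCycle _ _).2 ?_
    rw [← Equiv.Perm.sameCycle_pow_left (n := (i : ℕ)), hij, Equiv.Perm.sameCycle_pow_left]
  subst ho
  rcases le_total i j with hle | hle
  · rw [aux _ i j hij hle]
  · rw [aux _ j i hij.symm hle]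

/-- A dart whose initial vertex has another dart is not fixed by the rotation. -/
theorem rot_ne_self (ρ : RotationSystem G) {d d' : G.Dart} (hfst : d.toProd.1 = d'.toProd.1)
    (hne : d ≠ d') : ρ.rot d ≠ d := by
  intro h
  obtain ⟨k, rfl⟩ := ρ.cyclic d d' hfst
  exact hne (Equiv.Perm.zpow_apply_eq_self_of_apply_eq_self h k).symm

end RotationSystem

/-- The bijection between darts induced by a graph isomorphism. -/
def SimpleGraph.Iso.dartEquiv {V W : Type*} {G : SimpleGraph V} {H : SimpleGraph W}
    (e : G ≃g H) : G.Dart ≃ H.Dart where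
  toFun := e.toHom.mapDart
  invFun := e.symm.toHom.mapDart
  left_inv d := by ext <;> simp
  right_inv d := by ext <;> simp

/-- Embeddability in a given genus is invariant under graph isomorphism. -/
theorem SimpleGraph.EmbedsInGenus.of_iso {V W : Type*} {G : SimpleGraph V} {H : SimpleGraph W}
    {g : ℕ} (h : G.EmbedsInGenus g) (e : G ≃g H) : H.EmbedsInGenus g := by
  obtain ⟨ρ, hρ⟩ := h
  have hpow : ∀ (f : Equiv.Perm G.Dart) (f' : Equiv.Perm H.Dart),
      (∀ d, f' (e.dartEquiv d) = e.dartEquiv (f d)) →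
      ∀ d d', f.SameCycle d d' → f'.SameCycle (e.dartEquiv d) (e.dartEquiv d') := by
    rintro f f' hf d _ ⟨k, rfl⟩
    have hf' : f' = e.dartEquiv.permCongrHom f := by
      ext1 x
      obtain ⟨d, rfl⟩ := e.dartEquiv.surjective x
      simp [hf, Equiv.permCongrHom]
    refine ⟨k, ?_⟩
    rw [hf', ← map_zpow]
    simp [Equiv.permCongrHom]
  let ρ' : RotationSystem H :=
    { rot := e.dartEquiv.permCongr ρ.rot
      fst_rot := by
        intro x
        obtain ⟨d, rfl⟩ := e.dartEquiv.surjective x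
        rw [Equiv.permCongr_apply, Equiv.symm_apply_apply]
        exact congrArg e (ρ.fst_rot d)
      cyclic := by
        intro x x' hx
        obtain ⟨d, rfl⟩ := e.dartEquiv.surjective x
        obtain ⟨d', rfl⟩ := e.dartEquiv.surjective x'
        exact hpow _ _ (by simp) d d' (ρ.cyclic d d' (e.injective hx)) }
  have hface : ∀ d, ρ'.face (e.dartEquiv d) = e.dartEquiv (ρ.face d) := by
    intro d
    have : (e.dartEquiv d).symm = e.dartEquiv d.symm := rfl
    simp [RotationSystem.face_apply, this, ρ']
  have hF : ρ'.numFaces = ρ.numFaces := by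
    refine ρ'.numFaces_eq_card
      (Q := Quotient (MulAction.orbitRel (Subgroup.zpowers ρ.face) G.Dart))
      (fun x => Quotient.mk _ (e.dartEquiv.symm x)) ?_ ?_ ?_
    · exact Quotient.mk_surjective.comp e.dartEquiv.symm.surjective
    · intro x
      obtain ⟨d, rfl⟩ := e.dartEquiv.surjective x
      rw [hface, Equiv.symm_apply_apply, Equiv.symm_apply_apply, ρ.mk_eq_mk_iff_sameCycle]
      exact Equiv.Perm.sameCycle_apply_left.2 (Equiv.Perm.SameCycle.refl _ _)
    · intro x x' hx
      obtain ⟨d, rfl⟩ := e.dartEquiv.surjective x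
      obtain ⟨d', rfl⟩ := e.dartEquiv.surjective x'
      rw [Equiv.symm_apply_apply, Equiv.symm_apply_apply, ρ.mk_eq_mk_iff_sameCycle] at hx
      exact hpow _ _ hface d d' hx
  refine ⟨ρ', ?_⟩
  rw [hF, ← Nat.card_congr e.toEquiv, ← Nat.card_congr e.dartEquiv]
  exact hρ

namespace CompleteBipartite

variable {α β : Type*}

/-- Darts of a complete bipartite graph: the first summand consists of the darts leaving the
left part. -/
noncomputable def dartEquiv (α β : Type*) :
    (α × β) ⊕ (α × β) ≃ (completeBipartiteGraph α β).Dart :=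
  Equiv.ofBijective
    (Sum.elim (fun x => ⟨(Sum.inl x.1, Sum.inr x.2), by simp⟩)
      (fun x => ⟨(Sum.inr x.2, Sum.inl x.1), by simp⟩))
    ⟨by
      rintro (⟨a, b⟩ | ⟨a, b⟩) (⟨a', b'⟩ | ⟨a', b'⟩) h <;>
        simp_all [SimpleGraph.Dart.ext_iff, Prod.ext_iff],
     by
      rintro ⟨⟨a | b, a' | b'⟩, h⟩
      · simp at h
      · exact ⟨Sum.inl (a, b'), rfl⟩
      · exact ⟨Sum.inr (a', b), rfl⟩
      · simp at h⟩

theorem dartEquiv_inl_fst (x : α × β) : (dartEquiv α β (Sum.inl x)).toProd.1 = Sum.inl x.1 := rfl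

theorem dartEquiv_inr_fst (x : α × β) : (dartEquiv α β (Sum.inr x)).toProd.1 = Sum.inr x.2 := rfl

theorem dartEquiv_symm (x : (α × β) ⊕ (α × β)) :
    (dartEquiv α β x).symm = dartEquiv α β x.swap := by
  rcases x with x | x <;> rfl

theorem card_dart [Finite α] [Finite β] :
    Nat.card (completeBipartiteGraph α β).Dart = 2 * (Nat.card α * Nat.card β) := by
  rw [← Nat.card_congr (dartEquiv α β), Nat.card_sum, Nat.card_prod, two_mul]

/-- The rotation system of a complete bipartite graph with prescribed cyclic permutations
of the neighbours of every vertex. -/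
noncomputable def rotationSystem (σ : α → Equiv.Perm β) (τ : β → Equiv.Perm α)
    (hσ : ∀ a b b', (σ a).SameCycle b b') (hτ : ∀ b a a', (τ b).SameCycle a a') :
    RotationSystem (completeBipartiteGraph α β) where
  rot := (dartEquiv α β).permCongr
    (Equiv.sumCongr (Equiv.prodCongrRight σ) (Equiv.prodCongrLeft τ))
  fst_rot d := by
    obtain ⟨x | x, rfl⟩ := (dartEquiv α β).surjective d <;>
      simp [dartEquiv_inl_fst, dartEquiv_inr_fst]
  cyclic d d' h := by
    have hzpow : ∀ (k : ℤ) (x : (α × β) ⊕ (α × β)),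
        ((dartEquiv α β).permCongr (Equiv.sumCongr (Equiv.prodCongrRight σ)
          (Equiv.prodCongrLeft τ)) ^ k) (dartEquiv α β x) =
        dartEquiv α β (Sum.elim (fun y => Sum.inl (y.1, (σ y.1 ^ k) y.2))
          (fun y => Sum.inr ((τ y.2 ^ k) y.1, y.2)) x) := by
      intro k
      induction k with
      | zero => rintro (x | x) <;> simp
      | succ k ih =>
        rintro (⟨a, b⟩ | ⟨a, b⟩) <;> rw [zpow_add_one, Equiv.Perm.mul_apply] <;>
          simp only [Equiv.permCongr_apply, Equiv.symm_apply_apply, Equiv.sumCongr_apply,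
            Sum.map_inl, Sum.map_inr, Equiv.prodCongrRight_apply, Equiv.prodCongrLeft_apply, ih,
            Sum.elim_inl, Sum.elim_inr, zpow_add_one, Equiv.Perm.mul_apply]
      | pred k ih =>
        intro x
        rw [zpow_sub_one, Equiv.Perm.mul_apply]
        have : ((dartEquiv α β).permCongr (Equiv.sumCongr (Equiv.prodCongrRight σ)
            (Equiv.prodCongrLeft τ)))⁻¹ (dartEquiv α β x) =
            dartEquiv α β (Sum.elim (fun y => Sum.inl (y.1, (σ y.1)⁻¹ y.2))
              (fun y => Sum.inr ((τ y.2)⁻¹ y.1, y.2)) x) := by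
          rw [Equiv.Perm.inv_eq_iff_eq]
          rcases x with x | x <;> simp
        rw [this, ih]
        rcases x with x | x <;> simp [zpow_sub_one]
    obtain ⟨⟨a, b⟩ | ⟨a, b⟩, rfl⟩ := (dartEquiv α β).surjective d <;>
      obtain ⟨⟨a', b'⟩ | ⟨a', b'⟩, rfl⟩ := (dartEquiv α β).surjective d' <;>
      simp only [dartEquiv_inl_fst, dartEquiv_inr_fst, Sum.inl.injEq, Sum.inr.injEq,
        reduceCtorEq] at h <;> subst h
    · obtain ⟨k, hk⟩ := hσ a b b'
      exact ⟨k, by rw [hzpow]; simp [hk]⟩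
    · obtain ⟨k, hk⟩ := hτ b a a'
      exact ⟨k, by rw [hzpow]; simp [hk]⟩

section

variable (σ : α → Equiv.Perm β) (τ : β → Equiv.Perm α)
  (hσ : ∀ a b b', (σ a).SameCycle b b') (hτ : ∀ b a a', (τ b).SameCycle a a')

theorem face_inl (a : α) (b : β) :
    (rotationSystem σ τ hσ hτ).face (dartEquiv α β (Sum.inl (a, b))) =
      dartEquiv α β (Sum.inr (τ b a, b)) := by
  simp [RotationSystem.face_apply, dartEquiv_symm, rotationSystem]

theorem face_inr (a : α) (b : β) :
    (rotationSystem σ τ hσ hτ).face (dartEquiv α β (Sum.inr (a, b))) =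
      dartEquiv α β (Sum.inl (a, σ a b)) := by
  simp [RotationSystem.face_apply, dartEquiv_symm, rotationSystem]

/-- Two steps along a face of the rotation system, starting on the left part. -/
theorem sameCycle_face_step (a : α) (b : β) :
    (rotationSystem σ τ hσ hτ).face.SameCycle (dartEquiv α β (Sum.inl (a, b)))
      (dartEquiv α β (Sum.inl (τ b a, σ (τ b a) b))) := by
  rw [← face_inr σ τ hσ hτ, Equiv.Perm.sameCycle_apply_right, ← face_inl σ τ hσ hτ,
    Equiv.Perm.sameCycle_apply_right]

/-- Counting the faces through a labelling `q` of the darts leaving the left part, with a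
representative `r` of each face. -/
theorem numFaces_rotationSystem {Q : Type*} (q : α → β → Q) (r : Q → α × β)
    (hr : ∀ x, q (r x).1 (r x).2 = x)
    (hq : ∀ a b, q (τ b a) (σ (τ b a) b) = q a b)
    (hcycle : ∀ a b, (rotationSystem σ τ hσ hτ).face.SameCycle
      (dartEquiv α β (Sum.inl (a, b))) (dartEquiv α β (Sum.inl (r (q a b))))) :
    (rotationSystem σ τ hσ hτ).numFaces = Nat.card Q := by
  let q' : (completeBipartiteGraph α β).Dart → Q := fun d =>
    Sum.elim (fun x => q x.1 x.2) (fun x => q x.1 (σ x.1 x.2)) ((dartEquiv α β).symm d)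
  have hrep : ∀ d, (rotationSystem σ τ hσ hτ).face.SameCycle d
      (dartEquiv α β (Sum.inl (r (q' d)))) := by
    intro d
    obtain ⟨⟨a, b⟩ | ⟨a, b⟩, rfl⟩ := (dartEquiv α β).surjective d
    · simpa [q'] using hcycle a b
    · rw [← Equiv.Perm.sameCycle_apply_left, face_inr]
      simpa [q'] using hcycle a (σ a b)
  refine RotationSystem.numFaces_eq_card _ q' ?_ ?_ ?_
  · intro x
    exact ⟨dartEquiv α β (Sum.inl (r x)), by simp [q', hr]⟩
  · intro d
    obtain ⟨⟨a, b⟩ | ⟨a, b⟩, rfl⟩ := (dartEquiv α β).surjective d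
    · rw [face_inl]
      simpa [q'] using hq a b
    · rw [face_inr]
      simp [q']
  · intro d d' h
    exact (hrep d).trans (h ▸ (hrep d').symm)

end

/-- Every face of a rotation system of a complete bipartite graph with both parts nontrivial
has length at least four. -/
theorem numFaces_mul_four_le [Finite α] [Finite β] [Nontrivial α] [Nontrivial β]
    (ρ : RotationSystem (completeBipartiteGraph α β)) :
    ρ.numFaces * 4 ≤ 2 * (Nat.card α * Nat.card β) := by
  have : Finite (completeBipartiteGraph α β).Dart := .of_equiv _ (dartEquiv α β)
  rw [← card_dart]
  have hside : ∀ d, (ρ.face d).toProd.1.isLeft = !d.toProd.1.isLeft := by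
    intro d
    rw [ρ.face_fst]
    obtain ⟨x | x, rfl⟩ := (dartEquiv α β).surjective d <;> rfl
  have hrot : ∀ d, ρ.rot d ≠ d := by
    intro d
    obtain ⟨⟨a, b⟩ | ⟨a, b⟩, rfl⟩ := (dartEquiv α β).surjective d
    · obtain ⟨b', hb⟩ := exists_ne b
      exact ρ.rot_ne_self (d' := dartEquiv α β (Sum.inl (a, b'))) rfl (by simp [hb.symm])
    · obtain ⟨a', ha⟩ := exists_ne a
      exact ρ.rot_ne_self (d' := dartEquiv α β (Sum.inr (a', b))) rfl (by simp [ha.symm])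
  refine ρ.numFaces_mul_le 4 fun d k hk0 hk4 h => ?_
  interval_cases k
  · have := congrArg (fun d => d.toProd.1.isLeft) h
    cases hl : d.toProd.1.isLeft <;> simp only [pow_one, hside, hl] at this <;> contradiction
  · have h2 : ρ.face (ρ.face d) = d := by simpa [pow_succ] using h
    refine hrot d.symm (SimpleGraph.Dart.ext _ _ (Prod.ext (ρ.fst_rot _) ?_))
    rw [← ρ.face_apply, ← ρ.face_fst, h2]
    rfl
  · have := congrArg (fun d => d.toProd.1.isLeft) h
    cases hl : d.toProd.1.isLeft <;>
      simp only [pow_succ, pow_zero, one_mul, Equiv.Perm.mul_apply, hside, hl] at this <;>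
      contradiction

end CompleteBipartite

namespace GenusThree

variable {R : Type*} (D : Set R)

/-- The cyclic shifts of the three left vertices, in opposite directions on the summands. -/
def shift : {x // x ∉ D} ⊕ R → Equiv.Perm (Fin 3)
  | .inl _ => Equiv.addRight 1
  | .inr _ => Equiv.subRight 1

theorem sameCycle_shift (b : {x // x ∉ D} ⊕ R) (a a' : Fin 3) :
    (shift D b).SameCycle a a' := by
  refine ⟨(((shift D b).symm 0 * (a - a') : Fin 3) : ℕ), ?_⟩
  rw [zpow_natCast]
  rcases b with b | b
  · change (Equiv.addRight (1 : Fin 3) ^ (((0 - 1) * (a - a') : Fin 3) : ℕ)) a = a'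
    revert a a'
    decide
  · change (Equiv.subRight (1 : Fin 3) ^ (((0 + 1) * (a - a') : Fin 3) : ℕ)) a = a'
    revert a a'
    decide

variable [AddCommGroup R]

open Classical in
/-- The map moving each `x ∉ D` of the first summand to `x - u` in the second one, and each `x`
of the second summand to `x + v` in the first one, continuing if `x + v ∈ D`. -/
noncomputable def step (u v : R) : {x // x ∉ D} ⊕ R → {x // x ∉ D} ⊕ R
  | .inl x => .inr (x - u)
  | .inr x => if h : x + v ∈ D then .inr (x + v - u) else .inl ⟨x + v, h⟩

theorem step_step (u v : R) (x : {x // x ∉ D} ⊕ R) : step D u v (step D v u x) = x := by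
  rcases x with ⟨x, hx⟩ | x
  · simp [step, hx]
  · by_cases h : x + u ∈ D <;> simp [step, h]

/-- `step` as a permutation. -/
noncomputable def stepPerm (u v : R) : Equiv.Perm ({x // x ∉ D} ⊕ R) :=
  ⟨step D u v, step D v u, step_step D v u, step_step D u v⟩

theorem stepPerm_inl (u v : R) (x : {x // x ∉ D}) :
    stepPerm D u v (.inl x) = .inr (x - u) := rfl

theorem stepPerm_inr_of_mem (u v : R) {x : R} (h : x + v ∈ D) :
    stepPerm D u v (.inr x) = .inr (x + v - u) := by
  simp [stepPerm, step, h]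

theorem stepPerm_inr_of_notMem (u v : R) {x : R} (h : x + v ∉ D) :
    stepPerm D u v (.inr x) = .inl ⟨x + v, h⟩ := by
  simp [stepPerm, step, h]

theorem sameCycle_stepPerm_inr_add (u v x : R) :
    (stepPerm D u v).SameCycle (.inr x) (.inr (x + (v - u))) := by
  rw [← add_sub_assoc]
  by_cases h : x + v ∈ D
  · rw [← stepPerm_inr_of_mem D u v h, Equiv.Perm.sameCycle_apply_right]
  · have : (Sum.inr (x + v - u) : {x // x ∉ D} ⊕ R) = stepPerm D u v (.inl ⟨x + v, h⟩) := rfl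
    rw [this, ← stepPerm_inr_of_notMem D u v h, Equiv.Perm.sameCycle_apply_right,
      Equiv.Perm.sameCycle_apply_right]

theorem sameCycle_stepPerm (u v : R) (hgen : ∀ x : R, ∃ k : ℕ, k • (v - u) = x)
    (x y : {x // x ∉ D} ⊕ R) : (stepPerm D u v).SameCycle x y := by
  have hN : ∀ x : R, (stepPerm D u v).SameCycle (.inr 0) (.inr x) := by
    intro x
    obtain ⟨k, rfl⟩ := hgen x
    induction k with
    | zero => rw [zero_smul]
    | succ k ih => rw [succ_nsmul]; exact ih.trans (sameCycle_stepPerm_inr_add D u v _)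
  have hall : ∀ x, (stepPerm D u v).SameCycle (.inr 0) x := by
    rintro (x | x)
    · rw [← Equiv.Perm.sameCycle_apply_right]
      exact hN _
    · exact hN x
  exact (hall x).symm.trans (hall y)

open Classical in
/-- The label of the face through a dart from a left vertex. -/
noncomputable def faceLabel (c : Fin 3 → R) (a : Fin 3) :
    {x // x ∉ D} ⊕ R → (Fin 3 × {x // x ∉ D}) ⊕ D
  | .inl x => .inl (a, x)
  | .inr x => if h : x + c a ∈ D then .inr ⟨x + c a, h⟩ else .inl (a - 1, ⟨x + c a, h⟩)

/-- A dart on the face with a given label. -/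
def faceRep (c : Fin 3 → R) : (Fin 3 × {x // x ∉ D}) ⊕ D → Fin 3 × ({x // x ∉ D} ⊕ R)
  | .inl x => (x.1, .inl x.2)
  | .inr x => (0, .inr (x - c 0))

/-- If the differences of `c` generate `R`, deleting `D` from one half of the right part of the
quadrangular embedding given by `c` leaves three faces per remaining vertex of this half and
one face per deleted vertex. -/
theorem exists_rotationSystem (c : Fin 3 → R)
    (hgen : ∀ (a : Fin 3) (x : R), ∃ k : ℕ, k • (c (a + 1) - c a) = x) :
    ∃ ρ : RotationSystem (completeBipartiteGraph (Fin 3) ({x // x ∉ D} ⊕ R)),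
      ρ.numFaces = Nat.card ((Fin 3 × {x // x ∉ D}) ⊕ D) := by
  let σ : Fin 3 → Equiv.Perm ({x // x ∉ D} ⊕ R) := fun a => stepPerm D (c a) (c (a + 1))
  have hσ : ∀ a b b', (σ a).SameCycle b b' := fun a => sameCycle_stepPerm D _ _ (hgen a)
  have hshl : ∀ x a, shift D (.inl x) a = a + 1 := fun _ _ => rfl
  have hshr : ∀ x a, shift D (.inr x) a = a - 1 := fun _ _ => rfl
  have hmem : ∀ a x, x + c a ∈ D → σ (a - 1) (.inr x) = .inr (x + c a - c (a - 1)) := by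
    intro a x h
    have := stepPerm_inr_of_mem D (c (a - 1)) (c (a - 1 + 1)) (x := x) (by simpa using h)
    simpa only [σ, sub_add_cancel] using this
  have hnot : ∀ a x (h : x + c a ∉ D), σ (a - 1) (.inr x) = .inl ⟨x + c a, h⟩ := by
    intro a x h
    have := stepPerm_inr_of_notMem D (c (a - 1)) (c (a - 1 + 1)) (x := x) (by simpa using h)
    simpa only [σ, sub_add_cancel] using this
  refine ⟨CompleteBipartite.rotationSystem σ (shift D) hσ (sameCycle_shift D),
    CompleteBipartite.numFaces_rotationSystem σ (shift D) hσ (sameCycle_shift D)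
      (faceLabel D c) (faceRep D c) ?_ ?_ ?_⟩
  · rintro (x | ⟨x, hx⟩)
    · rfl
    · simp [faceRep, faceLabel, hx]
  · rintro a (⟨x, hx⟩ | x)
    · simp [hshl, σ, stepPerm_inl, faceLabel, hx]
    · by_cases h : x + c a ∈ D
      · rw [hshr, hmem a x h]
        simp [faceLabel, h]
      · rw [hshr, hnot a x h]
        simp [faceLabel, h]
  · have hstep := CompleteBipartite.sameCycle_face_step σ (shift D) hσ (sameCycle_shift D)
    rintro a (x | x)
    · exact Equiv.Perm.SameCycle.refl _ _
    · by_cases h : x + c a ∈ D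
      · obtain ⟨y, rfl⟩ : ∃ y, y - c a = x := ⟨x + c a, by simp⟩
        have hy : y ∈ D := by simpa using h
        have hdown : ∀ a : Fin 3,
            (CompleteBipartite.rotationSystem σ (shift D) hσ (sameCycle_shift D)).face.SameCycle
              (CompleteBipartite.dartEquiv _ _ (Sum.inl (a, .inr (y - c a))))
              (CompleteBipartite.dartEquiv _ _ (Sum.inl (a - 1, .inr (y - c (a - 1))))) := by
          intro a
          have := hstep a (.inr (y - c a))
          rwa [hshr, hmem a _ (by simpa using hy), sub_add_cancel] at this
        have hlabel : faceLabel D c a (.inr (y - c a)) = .inr ⟨y, hy⟩ := by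
          simp [faceLabel, hy]
        rw [hlabel]
        change Equiv.Perm.SameCycle _ _
          (CompleteBipartite.dartEquiv _ _ (Sum.inl (0, Sum.inr (y - c 0))))
        fin_cases a
        · exact Equiv.Perm.SameCycle.refl _ _
        · exact hdown 1
        · exact (hdown 2).trans (hdown 1)
      · have := hstep a (.inr x)
        rw [hshr, hnot a x h] at this
        simpa [faceLabel, faceRep, h] using this

/-- The cyclically consecutive differences of `0, 1, 2` generate `ℤ/m` for odd `m`. -/
theorem exists_nsmul_eq (g : ℕ) (a : Fin 3) (x : ZMod (2 * g + 1)) :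
    ∃ k : ℕ,
      k • ((((a + 1 : Fin 3) : ℕ) : ZMod (2 * g + 1)) - ((a : ℕ) : ZMod (2 * g + 1))) = x := by
  have hm : (2 * g + 1 : ZMod (2 * g + 1)) = 0 := by
    exact_mod_cast ZMod.natCast_self (2 * g + 1)
  have key : ∀ t y : ZMod (2 * g + 1), y * t = x → ∃ k : ℕ, k • t = x := by
    intro t y h
    exact ⟨y.val, by rw [nsmul_eq_mul, ZMod.natCast_zmod_val, h]⟩
  fin_cases a
  · exact key _ x (by simp)
  · exact key _ x (by norm_num [Fin.val_add])
  · refine key _ (g * x) ?_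
    simp
    linear_combination (-x) * hm

end GenusThree

/-- `K_{3,b}` embeds in genus `⌈(b-2)/4⌉`. -/
theorem embedsInGenus_completeBipartiteGraph_three (b : ℕ) (hb : 2 ≤ b) :
    (completeBipartiteGraph (Fin 3) (Fin b)).EmbedsInGenus ((b - 2 + 3) / 4) := by
  set g := (b - 2 + 3) / 4 with hg
  have hcard : Nat.card (ZMod (2 * g + 1)) = 2 * g + 1 := Nat.card_zmod _
  obtain ⟨D, -, hD⟩ := Set.exists_subset_card_eq (s := (Set.univ : Set (ZMod (2 * g + 1))))
    (n := 4 * g + 2 - b) (by rw [Set.ncard_univ, hcard]; omega)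
  have hD' : Nat.card D = 4 * g + 2 - b := hD
  have hP : Nat.card {x // x ∉ D} = b - (2 * g + 1) := by
    have := Set.ncard_add_ncard_compl D
    rw [hcard, hD] at this
    change Dᶜ.ncard = _
    omega
  have hB : Nat.card ({x // x ∉ D} ⊕ ZMod (2 * g + 1)) = b := by
    rw [Nat.card_sum, hP, hcard]
    omega
  let e : {x // x ∉ D} ⊕ ZMod (2 * g + 1) ≃ Fin b := Finite.equivFinOfCardEq hB
  obtain ⟨ρ, hρ⟩ := GenusThree.exists_rotationSystem D
    (fun a => ((a : ℕ) : ZMod (2 * g + 1))) (GenusThree.exists_nsmul_eq g)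
  refine SimpleGraph.EmbedsInGenus.of_iso ⟨ρ, ?_⟩
    (⟨Equiv.sumCongr (Equiv.refl (Fin 3)) e, ?_⟩ :
      completeBipartiteGraph (Fin 3) ({x // x ∉ D} ⊕ ZMod (2 * g + 1)) ≃g _)
  · rw [hρ, CompleteBipartite.card_dart, Nat.card_sum, hB, Nat.card_sum, Nat.card_prod, hP, hD',
      Nat.card_fin]
    omega
  · rintro (x | x) (y | y) <;> simp

/-- The genus of `K_{3,b}` is `⌈(b−2)/4⌉` for `b ≥ 2`; consequently, if
`K_{3,b}` embeds in an orientable surface of genus `g`, then `b ≤ 4g + 2`. -/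
theorem genus_completeBipartiteGraph_three (b : ℕ) (hb : 2 ≤ b) :
    graphGenus (completeBipartiteGraph (Fin 3) (Fin b)) = (b - 2 + 3) / 4 ∧
    ∀ g : ℕ, graphGenus (completeBipartiteGraph (Fin 3) (Fin b)) ≤ g →
      b ≤ 4 * g + 2 := by
  have hgenus : graphGenus (completeBipartiteGraph (Fin 3) (Fin b)) = (b - 2 + 3) / 4 := by
    refine IsLeast.csInf_eq ⟨embedsInGenus_completeBipartiteGraph_three b hb, ?_⟩
    rintro g ⟨ρ, hρ⟩
    have : Nontrivial (Fin b) := Fin.nontrivial_iff_two_le.2 hb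
    have hF := CompleteBipartite.numFaces_mul_four_le ρ
    rw [CompleteBipartite.card_dart, Nat.card_sum] at hρ
    rw [Nat.card_fin, Nat.card_fin] at hρ hF
    omega
  refine ⟨hgenus, fun g hg => ?_⟩
  omega
end
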